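/- Let λ ≥ 0 and e ≥ 1 be integers with 2e ≥ λ − 2, and set r := 2e − λ + 1. Let M_{λ+1/2} and M_{r+1/2} denote the ℂ-vector spaces of holomorphic modular forms of weight λ+1/2, respectively r+1/2, on Γ₀(4). Define EV := { (a_f(0), a⁰_f(0), a_f(1), a_f(2), …, a_f(e)) : f ∈ M_{λ+1/2} } ⊆ ℂ^{e+2}, and let EL := { w ∈ ℂ^{e+2} : Σ_{i=1}^{e+2} w_i·v_i = 0 for all v ∈ EV }. For g ∈ M_{r+1/2}, the quotient g/R₄^e is a weakly holomorphic modular form of weight (1−λ)+1/2 on Γ₀(4); define Φ(g) := ( a_{g/R₄^e}(0), 4·a⁰_{g/R₄^e}(0), a_{g/R₄^e}(−1), a_{g/R₄^e}(−2), …, a_{g/R₄^e}(−e) ) ∈ ℂ^{e+2}. Then Φ : M_{r+1/2} → ℂ^{e+2} is a ℂ-linear isomorphism onto EL. -/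

import Mathlib

open Complex UpperHalfPlane Matrix MatrixGroups CongruenceSubgroup Filter Topology Manifold
open scoped Real NumberField

set_option synthInstance.maxHeartbeats 1000000
set_option maxHeartbeats 1000000

noncomputable section

/-- The Jacobi theta function `θ(τ) = Σ_{n ∈ ℤ} e^{2πin²τ}`. -/
def Theta (τ : ℍ) : ℂ := ∑' n : ℤ, Complex.exp (2 * Real.pi * Complex.I * (n : ℂ) ^ 2 * (τ : ℂ))

/-- `cτ + d` for `σ = (a,b;c,d) ∈ SL₂(ℤ)`. -/
def denomC (σ : SL(2, ℤ)) (τ : ℍ) : ℂ := (σ 1 0 : ℂ) * (τ : ℂ) + (σ 1 1 : ℂ)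

/-- `f` admits at the cusp `σ∞` an expansion `(cτ+d)^{-k} f(στ) = Σ_n c(n) e^{2πinτ/M}`
(principal branch) with coefficients `c`, width `M > 0`, coefficients vanishing below some `s₀`,
the series converging absolutely, and uniformly on `{Im τ ≥ y₀}` for every `y₀ > 0`. -/
def CuspExpansion (k : ℂ) (f : ℍ → ℂ) (σ : SL(2, ℤ)) (M : ℕ) (c : ℤ → ℂ) : Prop :=
  0 < M ∧ (∃ s₀ : ℤ, ∀ n : ℤ, n < s₀ → c n = 0) ∧
  ∀ y₀ : ℝ, 0 < y₀ →
    (∀ τ : ℍ, y₀ ≤ τ.im →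
      Summable fun n : ℤ => ‖c n * Complex.exp (2 * Real.pi * Complex.I * n * τ / M)‖) ∧
    TendstoUniformlyOn
      (fun (s : Finset ℤ) (τ : ℍ) =>
        ∑ n ∈ s, c n * Complex.exp (2 * Real.pi * Complex.I * n * τ / M))
      (fun τ => (denomC σ τ) ^ (-k) * f (σ • τ))
      Filter.atTop {τ : ℍ | y₀ ≤ τ.im}

/-- Weakly holomorphic modular form of weight `lam + 1/2` on `Γ₀(4N)`. -/
structure IsWeaklyHolo (N : ℕ) (lam : ℤ) (f : ℍ → ℂ) : Prop where
  holo : MDifferentiable 𝓘(ℂ) 𝓘(ℂ) f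
  transf : ∀ γ ∈ Gamma0 (4 * N), ∀ τ : ℍ,
    f (γ • τ) = (Theta (γ • τ) / Theta τ) ^ (2 * lam + 1 : ℤ) * f τ
  cusp : ∀ σ : SL(2, ℤ), ∃ (M : ℕ) (c : ℤ → ℂ), CuspExpansion ((lam : ℂ) + 1 / 2) f σ M c

/-- Holomorphic modular form of weight `lam + 1/2` on `Γ₀(4N)`: at every cusp one can take the
expansion to start at `0`. -/
structure IsHoloForm (N : ℕ) (lam : ℤ) (f : ℍ → ℂ) : Prop where
  holo : MDifferentiable 𝓘(ℂ) 𝓘(ℂ) f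
  transf : ∀ γ ∈ Gamma0 (4 * N), ∀ τ : ℍ,
    f (γ • τ) = (Theta (γ • τ) / Theta τ) ^ (2 * lam + 1 : ℤ) * f τ
  cusp : ∀ σ : SL(2, ℤ), ∃ (M : ℕ) (c : ℤ → ℂ),
    CuspExpansion ((lam : ℂ) + 1 / 2) f σ M c ∧ ∀ n : ℤ, n < 0 → c n = 0

/-- Cusp form of weight `lam + 1/2` on `Γ₀(4N)`: holomorphic form all of whose slashes tend to
`0` as `Im τ → ∞`. -/
structure IsCuspFormHalf (N : ℕ) (lam : ℤ) (f : ℍ → ℂ) : Prop where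
  toIsHoloForm : IsHoloForm N lam f
  decay : ∀ σ : SL(2, ℤ),
    Filter.Tendsto (fun τ : ℍ => (denomC σ τ) ^ (-((lam : ℂ) + 1 / 2)) * f (σ • τ))
      (Filter.comap UpperHalfPlane.im Filter.atTop) (nhds 0)

/-- `f(τ) = Σ_{n ∈ ℤ} a(n) e^{2πinτ}` is the Fourier expansion of `f` at `∞`. -/
def FourierAtInfty (f : ℍ → ℂ) (a : ℤ → ℂ) : Prop :=
  ∀ τ : ℍ, HasSum (fun n : ℤ => a n * Complex.exp (2 * Real.pi * Complex.I * n * τ)) (f τ)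

/-- `x ≡ y (mod 𝔭^j)` for elements of `ℂ` lying in `L`: `(x - y)·b = a` with `a ∈ 𝔭^j`,
`b ∉ 𝔭`, i.e. `v_𝔭(x - y) ≥ j`. -/
def CongMod (L : Subfield ℂ) (P : Ideal (𝓞 L)) (j : ℕ) (x y : ℂ) : Prop :=
  ∃ a b : 𝓞 L, a ∈ P ^ j ∧ b ∉ P ∧ (x - y) * ((b : L) : ℂ) = ((a : L) : ℂ)

/-- `x` is `𝔭`-integral: `x·b = a` with `a ∈ 𝒪_L`, `b ∈ 𝒪_L ∖ 𝔭`. -/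
def PIntegral (L : Subfield ℂ) (P : Ideal (𝓞 L)) (x : ℂ) : Prop :=
  ∃ a b : 𝓞 L, b ∉ P ∧ x * ((b : L) : ℂ) = ((a : L) : ℂ)

/-- The factor of the infinite product defining `R₄`. -/
def fac4 (τ : ℍ) (n : ℕ) : ℂ :=
  (1 - Complex.exp (2 * Real.pi * Complex.I * (τ : ℂ)) ^ (4 * (n + 1))) ^ 8 *
    ((1 - Complex.exp (2 * Real.pi * Complex.I * (τ : ℂ)) ^ (2 * (n + 1))) ^ 4)⁻¹

/-- `R₄(τ) = q·∏_{n≥1}(1−q^{4n})^8(1−q^{2n})^{−4}`, the eta-quotient `η(4z)^8/η(2z)^4`. -/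
def R4 (τ : ℍ) : ℂ := Complex.exp (2 * Real.pi * Complex.I * (τ : ℂ)) * ∏' n : ℕ, fac4 τ n

/-- The point `x + i ∈ ℍ`. -/
def hpt (x : ℝ) : ℍ := ⟨(x : ℂ) + Complex.I, by simp⟩

/-- The `n`-th Fourier coefficient of `g : ℍ → ℂ` with respect to the width `M`, computed by
integration at height `1`:  `(1/M)·∫₀^M g(x+i)·e^{−2πin(x+i)/M} dx`. -/
def fCoeff (M : ℕ) (n : ℤ) (g : ℍ → ℂ) : ℂ :=
  (1 / (M : ℂ)) * ∫ x in (0 : ℝ)..(M : ℝ),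
    g (hpt x) * Complex.exp (-(2 * Real.pi * Complex.I * n * ((x : ℂ) + Complex.I) / M))

/-- The weight-`w` slash of `f` by `S = (0,−1;1,0)`, i.e. `τ ↦ τ^{−w}·f(−1/τ)` (principal
branch). -/
def slashS (w : ℂ) (f : ℍ → ℂ) : ℍ → ℂ :=
  fun τ => ((τ : ℂ)) ^ (-w) * f (ModularGroup.S • τ)

/-- The constant term `a⁰_f(0)` of a form `f` of weight `w` at the cusp `0` (of width `4`). -/
def c0Coeff (w : ℂ) (f : ℍ → ℂ) : ℂ := fCoeff 4 0 (slashS w f)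

/-- `EV = {(a_f(0), a⁰_f(0), a_f(1), …, a_f(e)) : f ∈ M_{λ+1/2}(Γ₀(4))} ⊆ ℂ^{e+2}`. -/
def EV (lam : ℕ) (e : ℕ) : Set (Fin (e + 2) → ℂ) :=
  { v | ∃ f : ℍ → ℂ, IsHoloForm 1 (lam : ℤ) f ∧
      v = fun i : Fin (e + 2) =>
        if (i : ℕ) = 0 then fCoeff 1 0 f
        else if (i : ℕ) = 1 then c0Coeff ((lam : ℂ) + 1 / 2) f
        else fCoeff 1 (((i : ℕ) : ℤ) - 1) f }

/-- `EL` is the orthogonal complement of `EV` in `ℂ^{e+2}`. -/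
def EL (lam : ℕ) (e : ℕ) : Set (Fin (e + 2) → ℂ) :=
  { w | ∀ v ∈ EV lam e, ∑ i, w i * v i = 0 }

/-- The map `Φ(g) = (a_{g/R₄^e}(0), 4·a⁰_{g/R₄^e}(0), a_{g/R₄^e}(−1), …, a_{g/R₄^e}(−e))`,
where `g/R₄^e` has weight `(1−λ)+1/2`. -/
def PhiMap (lam : ℕ) (e : ℕ) (g : ℍ → ℂ) : Fin (e + 2) → ℂ :=
  fun i : Fin (e + 2) =>
    if (i : ℕ) = 0 then fCoeff 1 0 (fun τ => g τ / R4 τ ^ e)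
    else if (i : ℕ) = 1 then
      4 * c0Coeff ((1 - (lam : ℂ)) + 1 / 2) (fun τ => g τ / R4 τ ^ e)
    else fCoeff 1 (-(((i : ℕ) : ℤ) - 1)) (fun τ => g τ / R4 τ ^ e)

/-- The generator `(1,0;4,1)` of `Γ₀(4)`. -/
def matL : SL(2, ℤ) := ⟨!![1, 0; 4, 1], by simp [Matrix.det_fin_two]⟩

/-- The matrix `(1,0;2,1)`, which maps `∞` to the cusp `1/2`. -/
def matU : SL(2, ℤ) := ⟨!![1, 0; 2, 1], by simp [Matrix.det_fin_two]⟩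

lemma exists_two_mul_abs_add_mul_le (x m : ℤ) (hm : m ≠ 0) : ∃ n : ℤ, 2 * |x + n * m| ≤ |m| := by
  have h1 := Int.emod_nonneg x hm
  have h2 := Int.emod_lt_abs x hm
  have h3 := Int.emod_add_mul_ediv x m
  rcases le_or_gt (2 * (x % m)) |m| with h | h
  · refine ⟨-(x / m), ?_⟩
    have : x + -(x / m) * m = x % m := by linarith
    rw [this, abs_of_nonneg h1]; exact h
  · rcases le_total 0 m with hp | hp
    · rw [abs_of_nonneg hp] at *
      refine ⟨-(x / m) - 1, ?_⟩
      have : x + (-(x / m) - 1) * m = x % m - m := by linarith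
      rw [this, abs_of_nonpos (by linarith)]; linarith
    · rw [abs_of_nonpos hp] at *
      refine ⟨-(x / m) + 1, ?_⟩
      have : x + (-(x / m) + 1) * m = x % m + m := by linarith
      rw [this, abs_of_nonpos (by linarith)]; linarith

lemma matL_zpow (n : ℤ) : ((matL ^ n : SL(2, ℤ)) : Matrix (Fin 2) (Fin 2) ℤ) = !![1, 0; 4 * n, 1] := by
  induction n with
  | zero => simp [Matrix.one_fin_two]
  | succ n h =>
    rw [_root_.zpow_add_one, Matrix.SpecialLinearGroup.coe_mul, h]
    simp [matL]; ring
  | pred n h =>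
    rw [_root_.zpow_sub_one, Matrix.SpecialLinearGroup.coe_mul, h, Matrix.SpecialLinearGroup.coe_inv]
    simp [matL, Matrix.adjugate_fin_two]; ring

lemma gamma0_four_row (γ : SL(2, ℤ)) : γ ∈ Gamma0 4 ↔ (4 : ℤ) ∣ γ 1 0 := by
  rw [Gamma0_mem, ZMod.intCast_zmod_eq_zero_iff_dvd]; rfl

lemma sl_det (γ : SL(2, ℤ)) : γ 0 0 * γ 1 1 - γ 0 1 * γ 1 0 = 1 := by
  rw [← Matrix.det_fin_two]; exact γ.det_coe

lemma mul_T_zpow_row (γ : SL(2, ℤ)) (n : ℤ) :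
    (γ * ModularGroup.T ^ n) 1 0 = γ 1 0 ∧ (γ * ModularGroup.T ^ n) 1 1 = γ 1 1 + n * γ 1 0 := by
  simp [Matrix.SpecialLinearGroup.coe_mul, ModularGroup.coe_T_zpow, Matrix.mul_apply,
    Fin.sum_univ_two]
  ring

lemma mul_matL_zpow_row (γ : SL(2, ℤ)) (n : ℤ) :
    (γ * matL ^ n) 1 0 = γ 1 0 + n * (4 * γ 1 1) ∧ (γ * matL ^ n) 1 1 = γ 1 1 := by
  simp [Matrix.SpecialLinearGroup.coe_mul, matL_zpow, Matrix.mul_apply, Fin.sum_univ_two]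
  ring

lemma mul_inv_row (γ ρ : SL(2, ℤ)) : (γ * ρ⁻¹) 1 0 = γ 1 0 * ρ 1 1 - γ 1 1 * ρ 1 0 := by
  rw [Matrix.SpecialLinearGroup.coe_mul, Matrix.SpecialLinearGroup.coe_inv,
    Matrix.adjugate_fin_two, Matrix.mul_apply, Fin.sum_univ_two]
  simp
  ring

/-- `Γ₀(4)` is generated by `-1`, `T` and `(1,0;4,1)`. -/
lemma gamma0_four_le_closure :
    Gamma0 4 ≤ Subgroup.closure {ModularGroup.T, matL, -1} := by
  have hT : ModularGroup.T ∈ Subgroup.closure {ModularGroup.T, matL, -1} :=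
    Subgroup.subset_closure (by simp)
  have hL : matL ∈ Subgroup.closure {ModularGroup.T, matL, -1} :=
    Subgroup.subset_closure (by simp)
  have hN : (-1 : SL(2, ℤ)) ∈ Subgroup.closure {ModularGroup.T, matL, -1} :=
    Subgroup.subset_closure (by simp)
  suffices H : ∀ k : ℕ, ∀ γ : SL(2, ℤ), (4 : ℤ) ∣ γ 1 0 → (γ 1 0).natAbs = k →
      γ ∈ Subgroup.closure {ModularGroup.T, matL, -1} from
    fun γ hγ => H _ γ ((gamma0_four_row γ).1 hγ) rfl
  intro k
  induction k using Nat.strong_induction_on with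
  | _ k ih =>
  intro γ h4 hk
  by_cases hc : γ 1 0 = 0
  · have hd := sl_det γ
    rw [hc, mul_zero, sub_zero] at hd
    rcases Int.mul_eq_one_iff_eq_one_or_neg_one.1 hd with ⟨ha, hd⟩ | ⟨ha, hd⟩
    · have : γ = ModularGroup.T ^ (γ 0 1) := by
        ext i j
        rw [ModularGroup.coe_T_zpow]
        fin_cases i <;> fin_cases j <;> simp [ha, hd, hc]
      rw [this]; exact Subgroup.zpow_mem _ hT _
    · have : γ = (-1) * ModularGroup.T ^ (-γ 0 1) := by
        ext i j
        rw [neg_one_mul, Matrix.SpecialLinearGroup.coe_neg, ModularGroup.coe_T_zpow]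
        fin_cases i <;> fin_cases j <;> simp [ha, hd, hc]
      rw [this]; exact mul_mem hN (Subgroup.zpow_mem _ hT _)
  · obtain ⟨n, hn⟩ := exists_two_mul_abs_add_mul_le (γ 1 1) (γ 1 0) hc
    obtain ⟨r1, r2⟩ := mul_T_zpow_row γ n
    set γ' := γ * ModularGroup.T ^ n with hγ'
    have hdet := sl_det γ'
    have hodd : ¬ (2 : ℤ) ∣ γ' 1 1 := by
      rintro ⟨t, ht⟩
      obtain ⟨s, hs⟩ := h4
      rw [ht, r1, hs] at hdet
      have : 2 * (γ' 0 0 * t - γ' 0 1 * (2 * s)) = 1 := by linarith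
      omega
    have hd0 : γ' 1 1 ≠ 0 := fun h => hodd (by simp [h])
    obtain ⟨m, hm⟩ := exists_two_mul_abs_add_mul_le (γ' 1 0) (4 * γ' 1 1) (by omega)
    obtain ⟨s1, s2⟩ := mul_matL_zpow_row γ' m
    have hmem : γ' * matL ^ m ∈ Subgroup.closure {ModularGroup.T, matL, -1} := by
      refine ih _ ?_ _ ?_ rfl
      · rw [s1, ← hk]
        rw [← r2] at hn
        obtain ⟨s, hs⟩ := h4
        rw [abs_mul] at hm
        have : 2 * |γ' 1 1| ≠ |γ 1 0| := by
          rw [hs]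
          intro h
          rw [abs_mul] at h
          norm_num at h
          have h2 : |γ' 1 1| = 2 * |s| := by linarith
          exact hodd ((dvd_abs 2 _).1 ⟨_, h2⟩)
        norm_num at hm
        zify
        omega
      · rw [s1, r1]
        exact dvd_add h4 ⟨m * γ' 1 1, by ring⟩
    have : γ = (γ' * matL ^ m) * (matL ^ m)⁻¹ * (ModularGroup.T ^ n)⁻¹ := by
      rw [hγ']; group
    rw [this]
    exact mul_mem (mul_mem hmem (inv_mem (Subgroup.zpow_mem _ hL _)))
      (inv_mem (Subgroup.zpow_mem _ hT _))

/-- Coset representatives for `Γ₀(4)` in `SL₂(ℤ)`. -/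
lemma exists_cusp_decomp (σ : SL(2, ℤ)) : ∃ γ ∈ Gamma0 4, ∃ ρ : SL(2, ℤ), ∃ n : ℤ,
    (ρ = 1 ∨ ρ = ModularGroup.S ∨ ρ = matU) ∧ σ = γ * ρ * ModularGroup.T ^ n := by
  have hdet := sl_det σ
  by_cases h4 : (4 : ℤ) ∣ σ 1 0
  · exact ⟨σ, (gamma0_four_row σ).2 h4, 1, 0, Or.inl rfl, by simp⟩
  by_cases h2 : (2 : ℤ) ∣ σ 1 0
  · refine ⟨σ * matU⁻¹, (gamma0_four_row _).2 ?_, matU, 0, by simp, by simp⟩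
    have : (σ * matU⁻¹) 1 0 = σ 1 0 - 2 * σ 1 1 := by
      rw [mul_inv_row]; simp [matU]; ring
    rw [this]
    have hodd : ¬ (2 : ℤ) ∣ σ 1 1 := by
      rintro ⟨t, ht⟩
      obtain ⟨s, hs⟩ := h2
      rw [ht, hs] at hdet
      have : 2 * (σ 0 0 * t - σ 0 1 * s) = 1 := by linarith
      omega
    omega
  · have : ∃ n : ℤ, (4 : ℤ) ∣ σ 1 1 + (-n) * σ 1 0 := by
      refine ⟨σ 1 1 * σ 1 0, ?_⟩
      obtain ⟨t, ht⟩ : Odd (σ 1 0) := by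
        rw [← Int.not_even_iff_odd]; rwa [even_iff_two_dvd]
      refine ⟨-(t ^ 2 + t) * σ 1 1, ?_⟩
      rw [ht]; ring
    obtain ⟨n, hn⟩ := this
    refine ⟨σ * ModularGroup.T ^ (-n) * ModularGroup.S⁻¹, (gamma0_four_row _).2 ?_,
      ModularGroup.S, n, by simp, by group⟩
    have h := (mul_T_zpow_row σ (-n)).2
    set σ' := σ * ModularGroup.T ^ (-n)
    have : (σ' * ModularGroup.S⁻¹) 1 0 = - σ' 1 1 := by
      rw [mul_inv_row]; simp [ModularGroup.S]
    rw [this, h, dvd_neg]; exact hn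

lemma denomC_eq_denom (σ : SL(2, ℤ)) (τ : ℍ) : denomC σ τ = denom σ τ :=
  (ModularGroup.denom_apply σ τ).symm

lemma denomC_ne_zero (σ : SL(2, ℤ)) (τ : ℍ) : denomC σ τ ≠ 0 := by
  rw [denomC_eq_denom]; exact denom_ne_zero _ _

lemma coe_sl_smul (σ : SL(2, ℤ)) (τ : ℍ) :
    ((σ • τ : ℍ) : ℂ) = ((σ 0 0 : ℂ) * τ + (σ 0 1 : ℂ)) / denomC σ τ := by
  rw [UpperHalfPlane.specialLinearGroup_apply]
  simp [denomC]

lemma denomC_mul (γ σ : SL(2, ℤ)) (τ : ℍ) :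
    denomC (γ * σ) τ = denomC γ (σ • τ) * denomC σ τ := by
  have h := denomC_ne_zero σ τ
  rw [denomC, denomC, coe_sl_smul, Matrix.SpecialLinearGroup.coe_mul]
  simp only [Matrix.mul_apply, Fin.sum_univ_two]
  field_simp
  rw [denomC]
  push_cast
  ring

lemma coe_T_smul (τ : ℍ) : ((ModularGroup.T • τ : ℍ) : ℂ) = τ + 1 := by
  rw [coe_sl_smul]; simp [denomC, ModularGroup.T]

lemma coe_T_zpow_smul (n : ℤ) (τ : ℍ) : ((ModularGroup.T ^ n • τ : ℍ) : ℂ) = τ + n := by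
  rw [coe_sl_smul]; simp [denomC, ModularGroup.coe_T_zpow]

lemma coe_S_smul (τ : ℍ) : ((ModularGroup.S • τ : ℍ) : ℂ) = -1 / τ := by
  rw [coe_sl_smul]; simp [denomC, ModularGroup.S]

lemma coe_matL_smul (τ : ℍ) : ((matL • τ : ℍ) : ℂ) = τ / (4 * τ + 1) := by
  rw [coe_sl_smul]; simp [denomC, matL]

lemma coe_matU_smul (τ : ℍ) : ((matU • τ : ℍ) : ℂ) = τ / (2 * τ + 1) := by
  rw [coe_sl_smul]; simp [denomC, matU]

lemma denomC_one (τ : ℍ) : denomC 1 τ = 1 := by simp [denomC]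

lemma denomC_T_zpow (n : ℤ) (τ : ℍ) : denomC (ModularGroup.T ^ n) τ = 1 := by
  simp [denomC, ModularGroup.coe_T_zpow]

lemma denomC_S (τ : ℍ) : denomC ModularGroup.S τ = τ := by
  simp [denomC, ModularGroup.S]

lemma denomC_matL (τ : ℍ) : denomC matL τ = 4 * τ + 1 := by simp [denomC, matL]

lemma denomC_matU (τ : ℍ) : denomC matU τ = 2 * τ + 1 := by simp [denomC, matU]

lemma tendsto_T_zpow_smul (n : ℤ) :
    Tendsto (fun τ : ℍ => ModularGroup.T ^ n • τ) atImInfty atImInfty := by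
  rw [atImInfty, tendsto_comap_iff]
  refine tendsto_comap.congr fun τ => ?_
  have := congrArg Complex.im (coe_T_zpow_smul n τ)
  simpa using this.symm

lemma MDifferentiable.sl_smul {f : ℍ → ℂ} (hf : MDifferentiable 𝓘(ℂ) 𝓘(ℂ) f) (σ : SL(2, ℤ)) :
    MDifferentiable 𝓘(ℂ) 𝓘(ℂ) (fun τ => f (σ • τ)) :=
  hf.comp (UpperHalfPlane.mdifferentiable_smul (g := (σ : GL (Fin 2) ℝ)) (by simp))

lemma mdifferentiable_denomC (σ : SL(2, ℤ)) : MDifferentiable 𝓘(ℂ) 𝓘(ℂ) (denomC σ) := by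
  have : denomC σ = fun τ : ℍ => denom σ τ := funext fun τ => denomC_eq_denom σ τ
  rw [this]; exact UpperHalfPlane.mdifferentiable_denom _

lemma mdiff_mul {f g : ℍ → ℂ} (hf : MDifferentiable 𝓘(ℂ) 𝓘(ℂ) f)
    (hg : MDifferentiable 𝓘(ℂ) 𝓘(ℂ) g) : MDifferentiable 𝓘(ℂ) 𝓘(ℂ) (fun τ => f τ * g τ) := by
  rw [UpperHalfPlane.mdifferentiable_iff] at *
  exact hf.mul hg

lemma mdiff_pow {f : ℍ → ℂ} (hf : MDifferentiable 𝓘(ℂ) 𝓘(ℂ) f) (n : ℕ) :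
    MDifferentiable 𝓘(ℂ) 𝓘(ℂ) (fun τ => f τ ^ n) := by
  rw [UpperHalfPlane.mdifferentiable_iff] at *
  exact hf.pow n

lemma mdiff_inv {f : ℍ → ℂ} (hf : MDifferentiable 𝓘(ℂ) 𝓘(ℂ) f) (h0 : ∀ τ, f τ ≠ 0) :
    MDifferentiable 𝓘(ℂ) 𝓘(ℂ) (fun τ => (f τ)⁻¹) := by
  rw [UpperHalfPlane.mdifferentiable_iff] at *
  exact hf.inv fun z _ => h0 _

lemma mdiff_div {f g : ℍ → ℂ} (hf : MDifferentiable 𝓘(ℂ) 𝓘(ℂ) f)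
    (hg : MDifferentiable 𝓘(ℂ) 𝓘(ℂ) g) (h0 : ∀ τ, g τ ≠ 0) :
    MDifferentiable 𝓘(ℂ) 𝓘(ℂ) (fun τ => f τ / g τ) := by
  simp only [div_eq_mul_inv]
  exact mdiff_mul hf (mdiff_inv hg h0)

/-- A holomorphic function on a neighbourhood of the range of a holomorphic `g`. -/
lemma mdifferentiable_comp_of_differentiableAt {F : ℂ → ℂ} {g : ℍ → ℂ}
    (hg : MDifferentiable 𝓘(ℂ) 𝓘(ℂ) g) (hF : ∀ τ, DifferentiableAt ℂ F (g τ)) :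
    MDifferentiable 𝓘(ℂ) 𝓘(ℂ) (fun τ => F (g τ)) := by
  rw [UpperHalfPlane.mdifferentiable_iff] at hg ⊢
  intro z hz
  have := (hF (ofComplex z)).comp_differentiableWithinAt z (f := g ∘ ofComplex) (hg z hz)
  exact this

lemma mdifferentiable_denomC_cpow (σ : SL(2, ℤ)) (k : ℂ) :
    MDifferentiable 𝓘(ℂ) 𝓘(ℂ) (fun τ => denomC σ τ ^ k) := by
  by_cases hc : σ 1 0 = 0
  · have : (fun τ => denomC σ τ ^ k) = fun _ => (σ 1 1 : ℂ) ^ k := by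
      funext τ; simp [denomC, hc]
    rw [this]; exact mdifferentiable_const
  · refine mdifferentiable_comp_of_differentiableAt (mdifferentiable_denomC σ)
      (F := fun z => z ^ k) fun τ => ?_
    refine (differentiableAt_id).cpow_const (Or.inr ?_)
    have h1 : (denomC σ τ).im = σ 1 0 * τ.im := by simp [denomC]
    rw [id, h1]
    exact mul_ne_zero (by exact_mod_cast hc) (ne_of_gt τ.im_pos)

/-- The weight `k` slash of `f` by `σ` (principal branch). -/
def sl (k : ℂ) (f : ℍ → ℂ) (σ : SL(2, ℤ)) (τ : ℍ) : ℂ := denomC σ τ ^ (-k) * f (σ • τ)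

lemma mdifferentiable_slash {f : ℍ → ℂ} (hf : MDifferentiable 𝓘(ℂ) 𝓘(ℂ) f) (k : ℂ)
    (σ : SL(2, ℤ)) : MDifferentiable 𝓘(ℂ) 𝓘(ℂ) (sl k f σ) :=
  (mdifferentiable_denomC_cpow σ _).mul (hf.sl_smul σ)

lemma sl_mul_apply (a b : ℂ) (f g : ℍ → ℂ) (σ : SL(2, ℤ)) (τ : ℍ) :
    sl a f σ τ * sl b g σ τ = sl (a + b) (fun τ => f τ * g τ) σ τ := by
  rw [sl, sl, sl, neg_add, Complex.cpow_add _ _ (denomC_ne_zero σ τ)]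
  ring

lemma sl_pow_apply (a : ℂ) (f : ℍ → ℂ) (σ : SL(2, ℤ)) (τ : ℍ) (n : ℕ) :
    sl a f σ τ ^ n = sl (n * a) (fun τ => f τ ^ n) σ τ := by
  rw [sl, sl, mul_pow, ← mul_neg, Complex.cpow_nat_mul]

lemma sl_inv_apply (a : ℂ) (f : ℍ → ℂ) (σ : SL(2, ℤ)) (τ : ℍ) :
    (sl a f σ τ)⁻¹ = sl (-a) (fun τ => (f τ)⁻¹) σ τ := by
  rw [sl, sl, mul_inv, Complex.cpow_neg (denomC σ τ) (-a)]

lemma sl_zpow_apply (a : ℂ) (f : ℍ → ℂ) (σ : SL(2, ℤ)) (τ : ℍ) (n : ℤ) :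
    sl a f σ τ ^ n = sl (n * a) (fun τ => f τ ^ n) σ τ := by
  rw [sl, sl, mul_zpow, ← mul_neg, Complex.cpow_int_mul]

lemma sl_zero_apply (f : ℍ → ℂ) (σ : SL(2, ℤ)) (τ : ℍ) : sl 0 f σ τ = f (σ • τ) := by
  simp [sl]

lemma sl_one_apply (k : ℂ) (f : ℍ → ℂ) (τ : ℍ) : sl k f 1 τ = f τ := by
  simp [sl, denomC_one]

lemma sl_two_apply (f : ℍ → ℂ) (σ : SL(2, ℤ)) (τ : ℍ) :
    sl 2 f σ τ = (denomC σ τ ^ 2)⁻¹ * f (σ • τ) := by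
  rw [sl, Complex.cpow_neg]
  norm_cast

lemma slashS_eq_sl (w : ℂ) (f : ℍ → ℂ) : slashS w f = sl w f ModularGroup.S := by
  funext τ; rw [slashS, sl, denomC_S]

/-- Slashes by elements of a double coset `Γ₀(4) ρ T^n` have equal norms up to translation. -/
lemma norm_sl_mul_mul (k : ℝ) {f : ℍ → ℂ} {γ : SL(2, ℤ)}
    (hf : ∀ τ, ‖f (γ • τ)‖ = ‖denomC γ τ‖ ^ k * ‖f τ‖) (ρ : SL(2, ℤ)) (n : ℤ) (τ : ℍ) :
    ‖sl k f (γ * ρ * ModularGroup.T ^ n) τ‖ = ‖sl k f ρ (ModularGroup.T ^ n • τ)‖ := by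
  have h1 := norm_pos_iff.2 (denomC_ne_zero γ (ρ • ModularGroup.T ^ n • τ))
  have h2 := norm_pos_iff.2 (denomC_ne_zero ρ (ModularGroup.T ^ n • τ))
  have h3 := (Real.rpow_pos_of_pos h1 k).ne'
  simp only [sl, norm_mul, ← Complex.ofReal_neg, Complex.norm_cpow_real]
  rw [denomC_mul, denomC_mul, denomC_T_zpow, mul_one, norm_mul, mul_smul, mul_smul, hf,
    Real.mul_rpow h1.le h2.le, Real.rpow_neg h1.le]
  field_simp

lemma isBoundedAtImInfty_sl_of_reps (k : ℝ) {f : ℍ → ℂ}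
    (hf : ∀ γ ∈ Gamma0 4, ∀ τ, ‖f (γ • τ)‖ = ‖denomC γ τ‖ ^ k * ‖f τ‖)
    (h1 : IsBoundedAtImInfty f) (hS : IsBoundedAtImInfty (sl k f ModularGroup.S))
    (hU : IsBoundedAtImInfty (sl k f matU)) (σ : SL(2, ℤ)) :
    IsBoundedAtImInfty (sl k f σ) := by
  obtain ⟨γ, hγ, ρ, n, hρ, rfl⟩ := exists_cusp_decomp σ
  have hb : IsBoundedAtImInfty (sl k f ρ) := by
    rcases hρ with rfl | rfl | rfl
    · convert h1 using 1
      funext τ; exact sl_one_apply _ _ _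
    · exact hS
    · exact hU
  have : (fun τ : ℍ => sl k f ρ (ModularGroup.T ^ n • τ)) =O[atImInfty] (1 : ℍ → ℝ) :=
    Asymptotics.IsBigO.comp_tendsto hb (tendsto_T_zpow_smul n)
  refine Asymptotics.IsBigO.trans
    (Asymptotics.IsBigO.of_bound' (Eventually.of_forall fun τ => ?_)) this
  rw [norm_sl_mul_mul k (hf γ hγ)]

/-- A holomorphic `Γ₀(4)`-invariant function bounded at the cusps is constant. -/
lemma eq_const_of_invariant {f : ℍ → ℂ} (hf : MDifferentiable 𝓘(ℂ) 𝓘(ℂ) f)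
    (hinv : ∀ γ ∈ Gamma0 4, ∀ τ, f (γ • τ) = f τ)
    (h1 : IsBoundedAtImInfty f) (hS : IsBoundedAtImInfty (fun τ => f (ModularGroup.S • τ)))
    (hU : IsBoundedAtImInfty (fun τ => f (matU • τ))) : ∃ c, ∀ τ, f τ = c := by
  have hb : ∀ σ : SL(2, ℤ), IsBoundedAtImInfty (fun τ => f (σ • τ)) := by
    intro σ
    have := isBoundedAtImInfty_sl_of_reps 0 (f := f) (fun γ hγ τ => by rw [hinv γ hγ]; simp) h1
      (by convert hS using 1; funext τ; simpa using sl_zero_apply f _ τ)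
      (by convert hU using 1; funext τ; simpa using sl_zero_apply f _ τ) σ
    convert this using 1
    funext τ; simpa using (sl_zero_apply f σ τ).symm
  let F : ModularForm ((Gamma0 4).map (SpecialLinearGroup.mapGL ℝ)) 0 :=
    { toFun := f
      slash_action_eq' := by
        rintro _ ⟨γ, hγ, rfl⟩
        funext τ
        have h := ModularForm.SL_slash_apply (f := f) (k := 0) γ τ
        rw [ModularForm.SL_slash, hinv γ hγ, neg_zero, zpow_zero, mul_one] at h
        exact h
      holo' := hf
      bdd_at_cusps' := by
        intro c hc
        rw [Subgroup.IsArithmetic.isCusp_iff_isCusp_SL2Z] at hc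
        rw [OnePoint.isBoundedAt_iff_forall_SL2Z hc]
        intro γ _
        convert hb γ using 1
        funext τ
        simp [ModularForm.SL_slash_apply] }
  obtain ⟨c, hc⟩ := ModularForm.eq_const_of_weight_zero F
  exact ⟨c, fun τ => congrFun hc τ⟩

/-- The Euler product `∏ (1 - q^{n+1})`. -/
def eulerP (q : ℂ) : ℂ := ∏' n : ℕ, (1 - q ^ (n + 1))

/-- The nome `e^{2πiz}`. -/
def nome (z : ℂ) : ℂ := Complex.exp (2 * Real.pi * Complex.I * z)

/-- The fourth power of the Dedekind eta function. -/
def etaFour (z : ℂ) : ℂ := ModularForm.eta z ^ 4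

lemma nome_add (z w : ℂ) : nome (z + w) = nome z * nome w := by
  rw [nome, nome, nome, ← Complex.exp_add]; ring_nf

lemma nome_neg (z : ℂ) : nome (-z) = (nome z)⁻¹ := by
  rw [nome, nome, ← Complex.exp_neg]; ring_nf

lemma nome_nat_mul (n : ℕ) (z : ℂ) : nome (n * z) = nome z ^ n := by
  rw [nome, nome, ← Complex.exp_nat_mul]; ring_nf

lemma nome_one : nome 1 = 1 := by simp [nome, Complex.exp_two_pi_mul_I]

lemma nome_add_one (z : ℂ) : nome (z + 1) = nome z := by rw [nome_add, nome_one, mul_one]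

lemma nome_ne_zero (z : ℂ) : nome z ≠ 0 := Complex.exp_ne_zero _

lemma norm_nome (z : ℂ) : ‖nome z‖ = Real.exp (-2 * Real.pi * z.im) := by
  simp [nome, Complex.norm_exp]

lemma norm_nome_lt_one {z : ℂ} (hz : 0 < z.im) : ‖nome z‖ < 1 := by
  rw [norm_nome, Real.exp_lt_one_iff]
  nlinarith [Real.pi_pos, mul_pos Real.pi_pos hz]

lemma differentiableAt_nome (z : ℂ) : DifferentiableAt ℂ nome z := by
  unfold nome; fun_prop

lemma eulerP_zero : eulerP 0 = 1 := by simp [eulerP]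

lemma differentiableAt_eulerP {q : ℂ} (hq : ‖q‖ < 1) : DifferentiableAt ℂ eulerP q :=
  ModularForm.differentiableOn_tprod_one_sub_pow.differentiableAt
    (Metric.isOpen_ball.mem_nhds (by simpa using hq))

lemma tendsto_eulerP : Tendsto eulerP (𝓝 0) (𝓝 1) := by
  have := (differentiableAt_eulerP (q := 0) (by simp)).continuousAt.tendsto
  rwa [eulerP_zero] at this

lemma etaFour_eq (z : ℂ) : etaFour z = nome (z / 6) * eulerP (nome z) ^ 4 := by
  rw [etaFour, ModularForm.eta, mul_pow, eulerP]
  simp only [ModularForm.eta_q_eq_pow, nome]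
  rw [Function.Periodic.qParam, ← Complex.exp_nat_mul]
  congr 2
  push_cast; ring

lemma etaFour_ne_zero {z : ℂ} (hz : 0 < z.im) : etaFour z ≠ 0 :=
  pow_ne_zero _ (ModularForm.eta_ne_zero hz)

lemma eulerP_nome_ne_zero {z : ℂ} (hz : 0 < z.im) : eulerP (nome z) ≠ 0 := by
  have := etaFour_ne_zero hz
  rw [etaFour_eq] at this
  exact fun h => this (by simp [h])

lemma differentiableAt_etaFour {z : ℂ} (hz : 0 < z.im) : DifferentiableAt ℂ etaFour z :=
  (ModularForm.differentiableAt_eta_of_mem_upperHalfPlaneSet hz).pow 4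

lemma etaFour_add_one (z : ℂ) : etaFour (z + 1) = nome (1 / 6) * etaFour z := by
  rw [etaFour_eq, etaFour_eq, nome_add_one, add_div, nome_add]; ring

lemma etaFour_neg_inv {z : ℂ} (hz : 0 < z.im) : etaFour (-1 / z) = -z ^ 2 * etaFour z := by
  have h := ModularForm.eta_comp_eq_csqrt_I_inv (x := z) hz
  have h0 : z ≠ 0 := by rintro rfl; simp at hz
  have hs : ∀ w : ℂ, w ≠ 0 → sqrt w ^ 4 = w ^ 2 := by
    intro w hw
    rw [sqrt_eq_exp hw, ← Complex.exp_nat_mul]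
    rw [show ((4 : ℕ) : ℂ) * (Complex.log w / 2) = (2 : ℕ) * Complex.log w by push_cast; ring,
      Complex.exp_nat_mul, Complex.exp_log hw]
  simp only [Function.comp_apply, Pi.smul_apply, Pi.mul_apply, smul_eq_mul] at h
  rw [etaFour, h, etaFour, mul_pow, mul_pow, inv_pow, hs _ I_ne_zero, hs _ h0, I_sq]
  ring

lemma R4_eq_eulerP (τ : ℍ) :
    R4 τ = nome τ * (eulerP (nome (4 * τ)) ^ 8 / eulerP (nome (2 * τ)) ^ 4) := by
  have h1 : ∀ m : ℕ, 0 < m → 0 < ((m : ℂ) * (τ : ℂ)).im := fun m hm => by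
    have := τ.im_pos
    simp only [Complex.mul_im, Complex.natCast_re, Complex.natCast_im, zero_mul, add_zero]
    positivity
  have hm : ∀ m : ℕ, 0 < m → Multipliable fun n : ℕ => 1 - nome (m * τ) ^ (n + 1) :=
    fun m hm => ModularForm.multipliable_one_sub_pow (norm_nome_lt_one (h1 m hm))
  have h2 := (hm 2 (by norm_num)).hasProd
  have h4 := (hm 4 (by norm_num)).hasProd
  have h2n := eulerP_nome_ne_zero (h1 2 (by norm_num))
  have := (h4.pow 8).mul ((h2.pow 4).inv₀ (pow_ne_zero _ h2n))
  have hf : fac4 τ = fun n => (1 - nome ((4 : ℕ) * τ) ^ (n + 1)) ^ 8 *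
      ((1 - nome ((2 : ℕ) * τ) ^ (n + 1)) ^ 4)⁻¹ := by
    funext n
    rw [fac4, nome_nat_mul, nome_nat_mul, ← pow_mul, ← pow_mul]; rfl
  rw [← hf] at this
  rw [R4, div_eq_mul_inv]
  exact congrArg₂ _ rfl (HasProd.tprod_eq this)

lemma R4_eq_etaFour (τ : ℍ) : R4 τ = etaFour (4 * τ) ^ 2 / etaFour (2 * τ) := by
  rw [R4_eq_eulerP, etaFour_eq, etaFour_eq]
  have : nome τ = nome (4 * τ / 6) ^ 2 / nome (2 * τ / 6) := by
    rw [← nome_nat_mul, div_eq_mul_inv, ← nome_neg, ← nome_add]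
    congr 1; push_cast; ring
  rw [this]
  have := nome_ne_zero (2 * τ / 6)
  field_simp

lemma nat_mul_im_pos {m : ℕ} (hm : 0 < m) (τ : ℍ) : 0 < ((m : ℂ) * (τ : ℂ)).im := by
  have := τ.im_pos
  simp only [Complex.mul_im, Complex.natCast_re, Complex.natCast_im, zero_mul, add_zero]
  positivity

lemma two_mul_im_pos (τ : ℍ) : 0 < (2 * (τ : ℂ)).im := nat_mul_im_pos (m := 2) (by norm_num) τ

lemma four_mul_im_pos (τ : ℍ) : 0 < (4 * (τ : ℂ)).im := nat_mul_im_pos (m := 4) (by norm_num) τ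

lemma R4_ne_zero (τ : ℍ) : R4 τ ≠ 0 := by
  rw [R4_eq_etaFour]
  exact div_ne_zero (pow_ne_zero _ (etaFour_ne_zero (four_mul_im_pos τ)))
    (etaFour_ne_zero (two_mul_im_pos τ))

lemma mdifferentiable_etaFour_comp {g : ℂ → ℂ} (hg : Differentiable ℂ g)
    (h : ∀ τ : ℍ, 0 < (g τ).im) : MDifferentiable 𝓘(ℂ) 𝓘(ℂ) (fun τ : ℍ => etaFour (g τ)) :=
  mdifferentiable_comp_of_differentiableAt (F := fun z => etaFour (g z))
    UpperHalfPlane.mdifferentiable_coe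
    fun τ => (differentiableAt_etaFour (h τ)).comp (τ : ℂ) (hg _)

lemma mdifferentiable_R4 : MDifferentiable 𝓘(ℂ) 𝓘(ℂ) R4 := by
  have h1 := mdifferentiable_etaFour_comp (g := fun z => 4 * z) (by fun_prop) four_mul_im_pos
  have h2 := mdifferentiable_etaFour_comp (g := fun z => 2 * z) (by fun_prop) two_mul_im_pos
  have h := mdiff_div (mdiff_pow h1 2) h2 fun τ => etaFour_ne_zero (two_mul_im_pos τ)
  have : R4 = fun τ : ℍ => etaFour (4 * τ) ^ 2 / etaFour (2 * τ) := funext R4_eq_etaFour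
  rwa [this]

/-- The point `-1/(4τ)`. -/
def fricke (τ : ℍ) : ℍ := ⟨-1 / (4 * τ), by
  rw [neg_div, one_div, Complex.neg_im, Complex.inv_im, neg_div, neg_neg]
  exact div_pos (four_mul_im_pos τ) (Complex.normSq_pos.2
    (mul_ne_zero (by norm_num) τ.ne_zero))⟩

lemma coe_fricke (τ : ℍ) : (fricke τ : ℂ) = -1 / (4 * τ) := rfl

lemma fricke_fricke (τ : ℍ) : fricke (fricke τ) = τ := by
  ext
  have := τ.ne_zero
  rw [coe_fricke, coe_fricke]; field_simp

lemma matL_smul_eq (τ : ℍ) : matL • τ = fricke (ModularGroup.T ^ (-1 : ℤ) • fricke τ) := by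
  ext
  have h1 := τ.ne_zero
  have h2 := denomC_ne_zero matL τ
  rw [denomC_matL] at h2
  rw [coe_matL_smul, coe_fricke, coe_T_zpow_smul, coe_fricke]
  have h3 : (4 : ℂ) * (-1 / (4 * τ) + ((-1 : ℤ) : ℂ)) = -(4 * τ + 1) / τ := by
    push_cast; field_simp; ring
  rw [h3]; field_simp

/-- Two functions on `ℍ` related by the Fricke involution, one of them periodic, have the expected
behaviour under `(1,0;4,1)`. -/
lemma matL_transf_of_fricke {f g : ℍ → ℂ} {c : ℂ}
    (h : ∀ τ, f (fricke τ) = c * (τ : ℂ) ^ 2 * g τ)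
    (hg : ∀ τ, g (ModularGroup.T • τ) = g τ) (τ : ℍ) :
    f (matL • τ) = denomC matL τ ^ 2 * f τ := by
  have h1 := τ.ne_zero
  set v := fricke τ with hv
  have hT : g (ModularGroup.T ^ (-1 : ℤ) • v) = g v := by
    rw [← hg, smul_smul]; simp
  have h3 : ((ModularGroup.T ^ (-1 : ℤ) • v : ℍ) : ℂ) = (4 * τ + 1) * v := by
    rw [coe_T_zpow_smul, hv, coe_fricke]; push_cast; field_simp; ring
  rw [matL_smul_eq, h, hT, h3, denomC_matL]
  conv_rhs => rw [← fricke_fricke τ, h, ← hv]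
  have h5 : fricke v = τ := by rw [hv, fricke_fricke]
  rw [h5]; ring

/-- A function with weight two behaviour under generators has it on `Γ₀(4)`. -/
lemma weight_transf_of_generators {f : ℍ → ℂ} (k : ℕ)
    (hT : ∀ τ, f (ModularGroup.T • τ) = f τ) 
    (hL : ∀ τ, f (matL • τ) = denomC matL τ ^ (2 * k) * f τ) :
    ∀ γ ∈ Gamma0 4, ∀ τ, f (γ • τ) = denomC γ τ ^ (2 * k) * f τ := by
  intro γ hγ
  refine Subgroup.closure_induction (p := fun γ _ => ∀ τ, f (γ • τ) = denomC γ τ ^ (2 * k) * f τ)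
    ?_ ?_ ?_ ?_ (gamma0_four_le_closure hγ)
  · rintro x (rfl | rfl | rfl) τ
    · have := denomC_T_zpow 1 τ
      rw [zpow_one] at this
      rw [hT, this]; simp
    · exact hL τ
    · have : ((-1 : SL(2, ℤ)) • τ) = τ := by
        ext; rw [coe_sl_smul]; simp [denomC]
      rw [this]; simp [denomC]
  · intro τ; simp [denomC_one]
  · intro x y _ _ hx hy τ
    rw [mul_smul, hx, hy, denomC_mul]; ring
  · intro x _ hx τ
    have h1 := hx (x⁻¹ • τ)
    have h2 := denomC_mul x x⁻¹ τ
    have h3 := denomC_ne_zero x (x⁻¹ • τ)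
    rw [smul_inv_smul] at h1
    rw [mul_inv_cancel, denomC_one] at h2
    rw [h1, ← mul_assoc, ← mul_pow, mul_comm (denomC x⁻¹ τ), ← h2, one_pow, one_mul]

lemma R4_T_smul (τ : ℍ) : R4 (ModularGroup.T • τ) = R4 τ := by
  rw [R4_eq_eulerP, R4_eq_eulerP, coe_T_smul, nome_add_one, mul_add, mul_add, nome_add, nome_add]
  have h (n : ℕ) : nome (n * 1) = 1 := by rw [nome_nat_mul, nome_one, one_pow]
  have h2 := h 2
  have h4 := h 4
  push_cast at h2 h4
  rw [h2, h4, mul_one, mul_one]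

lemma etaFour_fricke (n m : ℂ) (τ : ℍ) (hnm : n * m = 4) (hm : 0 < (m * (τ : ℂ)).im) :
    etaFour (n * fricke τ) = -(m * τ) ^ 2 * etaFour (m * τ) := by
  rw [← etaFour_neg_inv hm]
  congr 1
  have := τ.ne_zero
  have hm0 : m ≠ 0 := by rintro rfl; simp at hnm
  rw [coe_fricke]; field_simp; linear_combination (-1 : ℂ) * hnm

lemma R4_fricke (τ : ℍ) :
    R4 (fricke τ) = (-1 / 4) * (τ : ℂ) ^ 2 * (etaFour τ ^ 2 / etaFour (2 * τ)) := by
  have h1 := etaFour_fricke 4 1 τ (by norm_num) (by simpa using τ.im_pos)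
  have h2 := etaFour_fricke 2 2 τ (by norm_num) (two_mul_im_pos τ)
  have h3 := etaFour_ne_zero (two_mul_im_pos τ)
  have := τ.ne_zero
  rw [R4_eq_etaFour, h1, h2, one_mul]; field_simp; norm_num

lemma R4_gamma0 : ∀ γ ∈ Gamma0 4, ∀ τ, R4 (γ • τ) = denomC γ τ ^ 2 * R4 τ := by
  refine weight_transf_of_generators 1 R4_T_smul
    (matL_transf_of_fricke (g := fun τ => etaFour τ ^ 2 / etaFour (2 * τ)) R4_fricke ?_)
  intro τ
  have h1 := nome_ne_zero (1 / 6)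
  rw [coe_T_smul, etaFour_add_one, mul_add, mul_one, show (2 : ℂ) * τ + 2 = 2 * τ + 1 + 1 by ring,
    etaFour_add_one, etaFour_add_one]
  field_simp

lemma S_smul_eq_fricke (τ τ' : ℍ) (h : (τ' : ℂ) = τ / 4) : ModularGroup.S • τ = fricke τ' := by
  ext
  have := τ.ne_zero
  rw [coe_S_smul, coe_fricke, h]; field_simp

lemma etaFour_div_eq (a b : ℂ) (hb : 0 < b.im) (h : 2 * a = b) :
    etaFour a ^ 2 / etaFour b = eulerP (nome a) ^ 8 / eulerP (nome b) ^ 4 := by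
  have h2 := eulerP_nome_ne_zero hb
  have h3 : nome (a / 6) ^ 2 = nome (b / 6) := by
    rw [← nome_nat_mul]; congr 1; push_cast; rw [← h]; ring
  have := nome_ne_zero (b / 6)
  rw [etaFour_eq, etaFour_eq, mul_pow, h3]; field_simp

lemma sl_R4_S (τ : ℍ) : sl 2 R4 ModularGroup.S τ =
    (-1 / 64) * (eulerP (nome (τ / 4)) ^ 8 / eulerP (nome (τ / 2)) ^ 4) := by
  have h0 : 0 < ((τ : ℂ) / 4).im := by
    have := τ.im_pos
    simp only [Complex.div_ofNat_im, UpperHalfPlane.coe_im]; positivity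
  have h0' : 0 < ((τ : ℂ) / 2).im := by
    have := τ.im_pos
    simp only [Complex.div_ofNat_im, UpperHalfPlane.coe_im]; positivity
  have := τ.ne_zero
  rw [sl_two_apply, S_smul_eq_fricke τ ⟨τ / 4, h0⟩ rfl, R4_fricke, denomC_S]
  change _ * (_ * ((τ : ℂ) / 4) ^ 2 * (etaFour (τ / 4) ^ 2 / etaFour (2 * (τ / 4)))) = _
  rw [show (2 : ℂ) * (τ / 4) = τ / 2 by ring, etaFour_div_eq _ _ h0' (by ring)]
  field_simp; ring

lemma half_add_im_pos (τ : ℍ) : 0 < ((τ : ℂ) + 1 / 2).im := by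
  have := τ.im_pos
  simpa using this

lemma two_mul_add_one_ne_zero (τ : ℍ) : (2 * (τ : ℂ) + 1) ≠ 0 := by
  have := denomC_ne_zero matU τ
  rwa [denomC_matU] at this

lemma etaFour_four_matU (τ : ℍ) : etaFour (4 * (matU • τ : ℍ)) =
    -nome (1 / 6) ^ 2 * ((2 * τ + 1) / 2) ^ 2 * etaFour (τ + 1 / 2) := by
  have h := two_mul_add_one_ne_zero τ
  have h' : (τ : ℂ) + 1 / 2 ≠ 0 := fun h0 => h (by linear_combination 2 * h0)
  have : (4 : ℂ) * (matU • τ : ℍ) = -1 / (τ + 1 / 2) + 1 + 1 := by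
    rw [coe_matU_smul, show (τ : ℂ) + 1 / 2 = (2 * τ + 1) / 2 by ring, div_div_eq_mul_div,
      mul_div_assoc', div_add_one h, div_add_one h]
    ring
  rw [this, etaFour_add_one, etaFour_add_one, etaFour_neg_inv (half_add_im_pos τ)]
  ring

lemma etaFour_two_matU (τ : ℍ) : etaFour (2 * (matU • τ : ℍ)) =
    -nome (1 / 6) ^ 2 * (2 * τ + 1) ^ 2 * etaFour (2 * τ) := by
  have h := two_mul_add_one_ne_zero τ
  have : (2 : ℂ) * (matU • τ : ℍ) = -1 / (2 * τ + 1) + 1 := by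
    rw [coe_matU_smul]; field_simp; ring
  rw [this, etaFour_add_one, etaFour_neg_inv (by simpa using τ.im_pos), etaFour_add_one]
  ring

lemma etaFour_matU (τ : ℍ) : etaFour (matU • τ : ℍ) =
    (nome (1 / 6) ^ 2)⁻¹ * (2 * τ + 1) ^ 2 * etaFour τ := by
  have h := two_mul_add_one_ne_zero τ
  have h0 := τ.ne_zero
  have h1 := nome_ne_zero (1 / 6)
  have him : 0 < (-1 / (τ : ℂ)).im := by
    have := (ModularGroup.S • τ).im_pos
    rwa [← UpperHalfPlane.coe_im, coe_S_smul] at this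
  have h3 : etaFour (-1 / (τ : ℂ)) = nome (1 / 6) ^ 2 * etaFour (-1 / τ - 2) := by
    conv_lhs => rw [show -1 / (τ : ℂ) = -1 / τ - 2 + 1 + 1 by ring]
    rw [etaFour_add_one, etaFour_add_one]; ring
  have : (matU • τ : ℍ) = -1 / (-1 / (τ : ℂ) - 2) := by
    rw [coe_matU_smul, show -1 / (τ : ℂ) - 2 = -(2 * τ + 1) / τ by field_simp; ring]
    field_simp
  rw [this, etaFour_neg_inv (by simpa using him)]
  rw [etaFour_neg_inv τ.im_pos] at h3
  have h4 : etaFour (-1 / τ - 2) = (nome (1 / 6) ^ 2)⁻¹ * (-(τ : ℂ) ^ 2 * etaFour τ) := by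
    rw [h3]; field_simp
  rw [h4]; field_simp; ring

lemma sl_R4_matU (τ : ℍ) : sl 2 R4 matU τ =
    (-nome (1 / 6) ^ 2 * nome (1 / 6) / 16) *
      (eulerP (nome (τ + 1 / 2)) ^ 8 / eulerP (nome (2 * τ)) ^ 4) := by
  have h := two_mul_add_one_ne_zero τ
  have h1 := nome_ne_zero (1 / 6)
  have h2 := etaFour_div_eq (τ + 1 / 2) (2 * τ + 1) (by simpa using τ.im_pos) (by ring)
  have h3 := etaFour_ne_zero (two_mul_im_pos τ)
  rw [etaFour_add_one, nome_add_one] at h2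
  rw [← h2, sl_two_apply, denomC_matU, R4_eq_etaFour, etaFour_four_matU, etaFour_two_matU]
  field_simp; ring

lemma tendsto_nome {a : ℝ} (ha : 0 < a) (b : ℂ) :
    Tendsto (fun τ : ℍ => nome (a * τ + b)) atImInfty (𝓝 0) := by
  rw [tendsto_zero_iff_norm_tendsto_zero]
  simp only [norm_nome]
  refine Real.tendsto_exp_atBot.comp ?_
  have h : Tendsto (fun τ : ℍ => a * τ.im + b.im) atImInfty atTop :=
    tendsto_atTop_add_const_right _ _ (Tendsto.const_mul_atTop ha tendsto_comap)
  have h2 := h.const_mul_atTop_of_neg (r := -2 * Real.pi) (by nlinarith [Real.pi_pos])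
  refine h2.congr fun τ => ?_
  simp

lemma tendsto_eulerP_nome {a : ℝ} (ha : 0 < a) (b : ℂ) :
    Tendsto (fun τ : ℍ => eulerP (nome (a * τ + b))) atImInfty (𝓝 1) :=
  tendsto_eulerP.comp (tendsto_nome ha b)

lemma isBounded_of_tendsto {f : ℍ → ℂ} {c : ℂ} (h : Tendsto f atImInfty (𝓝 c)) :
    IsBoundedAtImInfty f := h.isBigO_one ℝ

lemma eq_const_of_pow_eq {φ : ℍ → ℂ} (hφ : Continuous φ) {n : ℕ} (hn : 0 < n) {c : ℂ}
    (h : ∀ τ, φ τ ^ n = c) (τ τ' : ℍ) : φ τ = φ τ' := by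
  have hfin : {z : ℂ | z ^ n = c}.Finite := by
    have : (Polynomial.X ^ n - Polynomial.C c : Polynomial ℂ) ≠ 0 :=
      Polynomial.X_pow_sub_C_ne_zero hn c
    refine (Polynomial.finite_setOfPred_isRoot this).subset fun z hz => ?_
    simp only [Set.mem_ofPred_eq] at hz
    simp [hz]
  refine isPreconnected_univ.constant_of_mapsTo hfin.isDiscrete hφ.continuousOn
    (fun τ _ => h τ) (Set.mem_univ _) (Set.mem_univ _)

lemma Theta_eq (τ : ℍ) : Theta τ = jacobiTheta (2 * τ) := by
  rw [Theta, jacobiTheta]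
  refine tsum_congr fun n => ?_
  ring_nf

lemma Theta_eq_two (τ : ℍ) : Theta τ = jacobiTheta₂ 0 (2 * τ) := by
  rw [Theta_eq, jacobiTheta_eq_jacobiTheta₂]

lemma mdifferentiable_Theta : MDifferentiable 𝓘(ℂ) 𝓘(ℂ) Theta := by
  have : Theta = fun τ : ℍ => jacobiTheta (2 * τ) := funext Theta_eq
  rw [this]
  exact mdifferentiable_comp_of_differentiableAt (F := fun z => jacobiTheta (2 * z))
    UpperHalfPlane.mdifferentiable_coe
    fun τ => (differentiableAt_jacobiTheta (two_mul_im_pos τ)).comp (τ : ℂ) (by fun_prop)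

lemma Theta_of_coe_add_one {τ τ' : ℍ} (h : (τ' : ℂ) = τ + 1) : Theta τ' = Theta τ := by
  rw [Theta_eq_two, Theta_eq_two, h, mul_add, mul_one, jacobiTheta₂_add_right]

lemma tendsto_Theta : Tendsto Theta atImInfty (𝓝 1) := by
  have h1 : Tendsto (fun τ : ℍ => (2 * (τ : ℂ))) atImInfty (comap Complex.im atTop) := by
    rw [tendsto_comap_iff]
    refine (Tendsto.const_mul_atTop (r := 2) (by norm_num) tendsto_comap).congr fun τ => ?_
    simp
  have h2 : Tendsto (fun z : ℂ => Real.exp (-Real.pi * z.im)) (comap Complex.im atTop) (𝓝 0) :=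
    Real.tendsto_exp_atBot.comp (tendsto_comap.const_mul_atTop_of_neg (by
      linarith [Real.pi_pos]))
  have h3 := (isBigO_at_im_infty_jacobiTheta_sub_one.trans_tendsto h2).comp h1
  have := h3.add_const 1
  simp only [zero_add, Function.comp_def, sub_add_cancel] at this
  exact this.congr fun τ => (Theta_eq τ).symm

lemma half_cpow_mul {r : ℝ} (hr : 0 < r) (τ : ℍ) :
    (-(r : ℂ) * Complex.I * τ) ^ (1 / 2 : ℂ) = (-(r : ℂ) * Complex.I) ^ (1 / 2 : ℂ) * (τ : ℂ) ^ (1 / 2 : ℂ) := by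
  have h0 : (-(r : ℂ) * Complex.I) ≠ 0 := by simp [hr.ne']
  have ha : (-(r : ℂ) * Complex.I).arg = -(Real.pi / 2) := by
    rw [show -(r : ℂ) * Complex.I = (r : ℂ) * (-Complex.I) by ring, Complex.arg_real_mul _ hr, Complex.arg_neg_I]
  have hp : 0 < (τ : ℂ).arg := by
    rcases (Complex.arg_nonneg_iff.2 τ.im_pos.le).lt_or_eq with h | h
    · exact h
    · have := (Complex.arg_eq_zero_iff.1 h.symm).2
      exact absurd this τ.im_pos.ne'
  rw [cpow_def_of_ne_zero (mul_ne_zero h0 τ.ne_zero), cpow_def_of_ne_zero h0,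
    cpow_def_of_ne_zero τ.ne_zero, Complex.log_mul h0 τ.ne_zero, add_mul, Complex.exp_add]
  rw [ha]
  constructor <;> linarith [Real.pi_pos, Complex.arg_le_pi (τ : ℂ)]

lemma half_cpow_pow_four (z : ℂ) : (z ^ (1 / 2 : ℂ)) ^ 4 = z ^ 2 := by
  rw [← cpow_nat_mul, ← cpow_natCast]; norm_num

/-- The transformation of `Theta` under the Fricke involution. -/
lemma Theta_fricke (τ : ℍ) : Theta (fricke τ) = (-((2 : ℝ) : ℂ) * Complex.I * τ) ^ (1 / 2 : ℂ) * Theta τ := by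
  have h := jacobiTheta₂_functional_equation 0 (2 * τ)
  have h1 : (-((2 : ℝ) : ℂ) * Complex.I * τ) ^ (1 / 2 : ℂ) ≠ 0 := by
    rw [Ne, cpow_eq_zero_iff]; simp [τ.ne_zero]
  have h2 : -Complex.I * (2 * (τ : ℂ)) = -((2 : ℝ) : ℂ) * Complex.I * τ := by push_cast; ring
  have h3 : 2 * (fricke τ : ℂ) = -1 / (2 * τ) := by
    rw [coe_fricke]; have := τ.ne_zero; field_simp; norm_num
  rw [Theta_eq_two, h3, Theta_eq_two τ, h, h2]
  simp only [zero_div, ne_eq, OfNat.ofNat_ne_zero, not_false_eq_true, zero_pow, mul_zero,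
    Complex.exp_zero]
  rw [mul_one, ← mul_assoc, mul_one_div_cancel h1, one_mul]

lemma Theta_fricke_pow (τ : ℍ) : Theta (fricke τ) ^ 4 = -4 * (τ : ℂ) ^ 2 * Theta τ ^ 4 := by
  rw [Theta_fricke, mul_pow, half_cpow_pow_four, mul_pow, mul_pow, Complex.I_sq]
  push_cast; ring

lemma sl_Theta_S (τ τ' : ℍ) (h : (τ' : ℂ) = τ / 4) : sl (1 / 2) Theta ModularGroup.S τ =
    (-((1 / 2 : ℝ) : ℂ) * Complex.I) ^ (1 / 2 : ℂ) * Theta τ' := by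
  have h1 : (τ : ℂ) ^ (1 / 2 : ℂ) ≠ 0 := by
    rw [Ne, cpow_eq_zero_iff]; simp [τ.ne_zero]
  rw [sl, S_smul_eq_fricke τ τ' h, Theta_fricke, denomC_S, cpow_neg, h,
    show -((2 : ℝ) : ℂ) * Complex.I * (τ / 4) = -((1 / 2 : ℝ) : ℂ) * Complex.I * τ by push_cast; ring,
    half_cpow_mul (by norm_num)]
  field_simp

/-- The even series `Σ e^{πi(n²+n)s}`. -/
def thetaB (s : ℂ) : ℂ := jacobiTheta₂ (s / 2) s

lemma thetaB_add_two (s : ℂ) : thetaB (s + 2) = thetaB s := by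
  rw [thetaB, jacobiTheta₂_add_right, add_div, div_self two_ne_zero, jacobiTheta₂_add_left, thetaB]

lemma two_mul_add_one_im_pos (τ : ℍ) : 0 < (2 * (τ : ℂ) + 1).im := by
  simpa using τ.im_pos

lemma isBounded_thetaB : IsBoundedAtImInfty (fun τ : ℍ => thetaB (2 * τ + 1)) := by
  have hs : Summable fun n : ℤ => ‖jacobiTheta₂_term n (Complex.I / 2) Complex.I‖ :=
    ((summable_jacobiTheta₂_term_iff (Complex.I / 2) Complex.I).2 (by simp)).norm
  refine isBoundedAtImInfty_iff.2 ⟨∑' n : ℤ, ‖jacobiTheta₂_term n (Complex.I / 2) Complex.I‖, 1, fun τ hτ => ?_⟩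
  have him := two_mul_add_one_im_pos τ
  rw [thetaB, jacobiTheta₂]
  refine tsum_of_norm_bounded hs.hasSum fun n => ?_
  have hn : (0 : ℝ) ≤ (n : ℝ) ^ 2 + n := by
    have : (0 : ℤ) ≤ n ^ 2 + n := by
      rcases le_or_gt 0 n with h | h <;> nlinarith
    exact_mod_cast this
  have key (s : ℂ) : ‖jacobiTheta₂_term n (s / 2) s‖ =
      Real.exp (-Real.pi * ((n : ℝ) ^ 2 + n) * s.im) := by
    rw [jacobiTheta₂_term, show 2 * ↑Real.pi * Complex.I * ↑n * (s / 2) + ↑Real.pi * Complex.I * ↑n ^ 2 * s =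
      (Real.pi * ((n : ℝ) ^ 2 + n) : ℝ) * (Complex.I * s) by push_cast; ring, Complex.norm_exp,
      Complex.re_ofReal_mul]
    simp
  rw [key, key]
  refine Real.exp_le_exp.2 ?_
  have h1 : (1 : ℝ) ≤ (2 * (τ : ℂ) + 1).im := by
    simp; linarith
  have h2 := mul_nonneg Real.pi_pos.le hn
  rw [Complex.I_im]
  nlinarith

lemma Theta_matU (τ : ℍ) : Theta (matU • τ) =
    (-((1 : ℝ) : ℂ) * Complex.I * (2 * τ + 1)) ^ (1 / 2 : ℂ) *
      Complex.exp (Real.pi * Complex.I * (2 * τ + 1) / 4) * thetaB (2 * τ + 1) := by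
  set s : ℂ := 2 * τ + 1 with hs
  have h0 : s ≠ 0 := two_mul_add_one_ne_zero τ
  have h := jacobiTheta₂_functional_equation (s / 2) s
  have h1 : (-Complex.I * s) ^ (1 / 2 : ℂ) ≠ 0 := by
    rw [Ne, cpow_eq_zero_iff]; simp [h0]
  have h2 : jacobiTheta₂ (1 / 2) (-1 / s) = Theta (matU • τ) := by
    have : 2 * ((matU • τ : ℍ) : ℂ) = -1 / s + 1 := by
      rw [coe_matU_smul, ← hs]; field_simp; rw [hs]; ring
    rw [Theta_eq_two, this, jacobiTheta₂, jacobiTheta₂]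
    refine tsum_congr fun n => ?_
    obtain ⟨k, hk⟩ : Even (n * (n - 1)) := Int.even_mul_pred_self n
    have hk' : (n : ℂ) ^ 2 = n + 2 * k := by
      have : n ^ 2 = n + 2 * k := by linarith
      exact_mod_cast this
    refine Complex.exp_eq_exp_iff_exists_int.2 ⟨-k, ?_⟩
    push_cast
    linear_combination (-(Real.pi : ℂ) * Complex.I) * hk'
  have h3 : s / 2 / s = 1 / 2 := by field_simp
  have h4 : -Real.pi * Complex.I * (s / 2) ^ 2 / s = -(Real.pi * Complex.I * s / 4) := by field_simp; norm_num
  rw [h3, h4, h2, Complex.exp_neg] at h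
  rw [thetaB, h, show -((1 : ℝ) : ℂ) * Complex.I * s = -Complex.I * s by push_cast; ring]
  have := Complex.exp_ne_zero (Real.pi * Complex.I * s / 4)
  field_simp

lemma exp_half_eq (τ : ℍ) : Complex.exp (Real.pi * Complex.I * (2 * τ + 1) / 4) =
    nome (1 / 8) * nome (τ / 4) := by
  rw [← nome_add, nome]; ring_nf

lemma Theta_matU_pow (τ : ℍ) : Theta (matU • τ) ^ 4 =
    (2 * τ + 1) ^ 2 * nome τ * thetaB (2 * τ + 1) ^ 4 := by
  rw [Theta_matU, mul_pow, mul_pow, half_cpow_pow_four, exp_half_eq, mul_pow (nome _),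
    ← nome_nat_mul, ← nome_nat_mul, mul_pow, mul_pow, Complex.I_sq]
  have : nome ((4 : ℕ) * (1 / 8)) = -1 := by
    rw [nome, show 2 * (Real.pi : ℂ) * Complex.I * ((4 : ℕ) * (1 / 8)) = Real.pi * Complex.I by push_cast; ring,
      Complex.exp_pi_mul_I]
  rw [this, show ((4 : ℕ) : ℂ) * (τ / 4) = τ by push_cast; ring]
  push_cast; ring

lemma sl_Theta_matU (τ : ℍ) : sl (1 / 2) Theta matU τ =
    (-((1 : ℝ) : ℂ) * Complex.I) ^ (1 / 2 : ℂ) * nome (1 / 8) * nome (τ / 4) * thetaB (2 * τ + 1) := by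
  have h1 : (2 * (τ : ℂ) + 1) ^ (1 / 2 : ℂ) ≠ 0 := by
    rw [Ne, cpow_eq_zero_iff]; simp [two_mul_add_one_ne_zero τ]
  have h2 := half_cpow_mul one_pos ⟨_, two_mul_add_one_im_pos τ⟩
  change (_ * (2 * (τ : ℂ) + 1)) ^ _ = _ * (2 * (τ : ℂ) + 1) ^ _ at h2
  rw [sl, denomC_matU, Theta_matU, h2, cpow_neg, exp_half_eq]
  field_simp

lemma Theta_pow_gamma0 : ∀ γ ∈ Gamma0 4, ∀ τ,
    Theta (γ • τ) ^ 4 = denomC γ τ ^ 2 * Theta τ ^ 4 := by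
  have hT : ∀ τ, Theta (ModularGroup.T • τ) ^ 4 = Theta τ ^ 4 := fun τ => by
    rw [Theta_of_coe_add_one (coe_T_smul τ)]
  exact weight_transf_of_generators (f := fun τ => Theta τ ^ 4) 1 hT
    (matL_transf_of_fricke (f := fun τ => Theta τ ^ 4) (g := fun τ => Theta τ ^ 4)
      Theta_fricke_pow hT)

/-- The eta quotient equal to `Theta⁻⁴`. -/
def etaQuot (τ : ℍ) : ℂ := etaFour τ ^ 2 * etaFour (4 * τ) ^ 2 / etaFour (2 * τ) ^ 5

lemma mdifferentiable_etaQuot : MDifferentiable 𝓘(ℂ) 𝓘(ℂ) etaQuot := by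
  have h1 := mdifferentiable_etaFour_comp (g := fun z => z) (by fun_prop) fun τ => τ.im_pos
  have h2 := mdifferentiable_etaFour_comp (g := fun z => 2 * z) (by fun_prop) two_mul_im_pos
  have h4 := mdifferentiable_etaFour_comp (g := fun z => 4 * z) (by fun_prop) four_mul_im_pos
  exact mdiff_div (mdiff_mul (mdiff_pow h1 2) (mdiff_pow h4 2)) (mdiff_pow h2 5)
    fun τ => pow_ne_zero _ (etaFour_ne_zero (two_mul_im_pos τ))

lemma etaQuot_T_smul (τ : ℍ) : etaQuot (ModularGroup.T • τ) = etaQuot τ := by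
  have h1 := nome_ne_zero (1 / 6)
  have h2 := etaFour_ne_zero (two_mul_im_pos τ)
  rw [etaQuot, coe_T_smul, show (4 : ℂ) * ((τ : ℂ) + 1) = 4 * τ + 1 + 1 + 1 + 1 by ring,
    show (2 : ℂ) * ((τ : ℂ) + 1) = 2 * τ + 1 + 1 by ring]
  simp only [etaFour_add_one]
  rw [etaQuot]; field_simp

lemma etaQuot_fricke (τ : ℍ) : etaQuot (fricke τ) = -(1 / 4) * ((τ : ℂ) ^ 2)⁻¹ * etaQuot τ := by
  have h1 := etaFour_fricke 4 1 τ (by norm_num) (by simpa using τ.im_pos)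
  have h2 := etaFour_fricke 2 2 τ (by norm_num) (two_mul_im_pos τ)
  have h3 := etaFour_fricke 1 4 τ (by norm_num) (four_mul_im_pos τ)
  have h4 := etaFour_ne_zero (two_mul_im_pos τ)
  have := τ.ne_zero
  rw [one_mul] at h1 h3
  rw [etaQuot, h1, h2, h3, etaQuot]; field_simp; ring

lemma etaQuot_eq_eulerP (τ : ℍ) : etaQuot τ = eulerP (nome τ) ^ 8 * eulerP (nome (4 * τ)) ^ 8 /
    eulerP (nome (2 * τ)) ^ 20 := by
  have h2 := eulerP_nome_ne_zero (two_mul_im_pos τ)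
  have e : nome (τ / 6) ^ 2 * nome (4 * τ / 6) ^ 2 = nome (2 * τ / 6) ^ 5 := by
    simp only [← nome_nat_mul, ← nome_add]; congr 1; push_cast; ring
  have := nome_ne_zero (2 * τ / 6)
  rw [etaQuot, etaFour_eq, etaFour_eq, etaFour_eq, mul_pow, mul_pow, mul_pow]
  rw [div_eq_div_iff (by positivity) (by positivity)]
  linear_combination (eulerP (nome τ) ^ 8 * eulerP (nome (4 * τ)) ^ 8 *
    eulerP (nome (2 * τ)) ^ 20) * e

lemma etaQuot_matU (τ : ℍ) : etaQuot (matU • τ) * ((2 * τ + 1) ^ 2 * nome τ) =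
    (nome (1 / 6) ^ 8)⁻¹ * (-1 / 16) * (eulerP (nome τ) ^ 8 * eulerP (nome (τ + 1 / 2)) ^ 8 /
      eulerP (nome (2 * τ)) ^ 20) * (nome (1 / 6) ^ 2)⁻¹ * nome (1 / 6) := by
  have h := two_mul_add_one_ne_zero τ
  have h1 := nome_ne_zero (1 / 6)
  have h2 := eulerP_nome_ne_zero (two_mul_im_pos τ)
  have e : nome (τ / 6) ^ 2 * nome ((τ + 1 / 2) / 6) ^ 2 * nome τ =
      nome (2 * τ / 6) ^ 5 * nome (1 / 6) := by
    simp only [← nome_nat_mul, ← nome_add]; congr 1; push_cast; ring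
  have := nome_ne_zero (2 * τ / 6)
  rw [etaQuot, etaFour_matU, etaFour_two_matU, etaFour_four_matU, etaFour_eq, etaFour_eq,
    etaFour_eq]
  generalize (τ : ℂ) + 1 / 2 = t at *
  field_simp
  linear_combination (-16 : ℂ) * eulerP (nome τ) ^ 8 * eulerP (nome t) ^ 8 * e

lemma tendsto_eulerP_nome_nat {m : ℕ} (hm : 0 < m) :
    Tendsto (fun τ : ℍ => eulerP (nome (m * τ))) atImInfty (𝓝 1) := by
  simpa using tendsto_eulerP_nome (a := m) (by exact_mod_cast hm) 0

lemma tendsto_etaQuot : Tendsto etaQuot atImInfty (𝓝 1) := by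
  have h1 := tendsto_eulerP_nome_nat one_pos
  have h2 := tendsto_eulerP_nome_nat two_pos
  have h4 := tendsto_eulerP_nome_nat four_pos
  have := ((h1.pow 8).mul (h4.pow 8)).div (h2.pow 20) (by simp)
  simp only [one_pow, mul_one, div_one] at this
  exact this.congr fun τ => by rw [etaQuot_eq_eulerP]; simp

/-- The point `τ/4`. -/
def quarter (τ : ℍ) : ℍ := ⟨(τ : ℂ) / 4, by
  have := τ.im_pos
  simp only [Complex.div_ofNat_im, UpperHalfPlane.coe_im]; positivity⟩

lemma coe_quarter (τ : ℍ) : (quarter τ : ℂ) = τ / 4 := rfl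

lemma tendsto_quarter : Tendsto quarter atImInfty atImInfty := by
  rw [atImInfty, tendsto_comap_iff]
  have := (tendsto_comap (f := UpperHalfPlane.im) (x := atTop)).atTop_div_const
    (show (0 : ℝ) < 4 by norm_num)
  refine this.congr fun τ => ?_
  simp [← UpperHalfPlane.coe_im, coe_quarter]

lemma Theta_pow_mul_etaQuot (τ : ℍ) : Theta τ ^ 4 * etaQuot τ = 1 := by
  set ψ : ℍ → ℂ := fun τ => Theta τ ^ 4 * etaQuot τ with hψ
  have hT (τ : ℍ) : ψ (ModularGroup.T • τ) = ψ τ := by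
    simp only [hψ, etaQuot_T_smul, Theta_of_coe_add_one (coe_T_smul τ)]
  have hF (τ : ℍ) : ψ (fricke τ) = ψ τ := by
    have := τ.ne_zero
    simp only [hψ, etaQuot_fricke, Theta_fricke_pow]; field_simp
  have hinv : ∀ γ ∈ Gamma0 4, ∀ τ, ψ (γ • τ) = ψ τ := by
    have := weight_transf_of_generators (f := ψ) 0 hT fun τ => by
      rw [matL_smul_eq, hF, ← hT, smul_smul]
      simp [hF]
    simpa using this
  have hlim : Tendsto ψ atImInfty (𝓝 1) := by
    simpa using (tendsto_Theta.pow 4).mul tendsto_etaQuot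
  obtain ⟨c, hc⟩ := eq_const_of_invariant
    (mdiff_mul (mdiff_pow mdifferentiable_Theta 4) mdifferentiable_etaQuot) hinv
    (isBounded_of_tendsto hlim)
    (by
      refine isBounded_of_tendsto (c := 1) ((hlim.comp tendsto_quarter).congr fun τ => ?_)
      rw [Function.comp_apply, S_smul_eq_fricke τ (quarter τ) rfl]
      exact (hF _).symm)
    (by
      have h1 := tendsto_eulerP_nome_nat one_pos
      have h2 := tendsto_eulerP_nome_nat two_pos
      have h4 := tendsto_eulerP_nome one_pos (1 / 2)
      have h := isBounded_of_tendsto (((((h1.pow 8).mul (h4.pow 8)).div (h2.pow 20)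
        (by simp)).const_mul ((nome (1 / 6) ^ 8)⁻¹ * (-1 / 16))).mul_const
          ((nome (1 / 6) ^ 2)⁻¹ * nome (1 / 6)))
      refine (h.mul (isBounded_thetaB.mul (isBounded_thetaB.mul
        (isBounded_thetaB.mul isBounded_thetaB)))).congr_left fun τ => ?_
      have := etaQuot_matU τ
      simp only [Pi.div_apply, Pi.mul_apply, Nat.cast_one, Nat.cast_ofNat,
        Complex.ofReal_one, one_mul]
      rw [Theta_matU_pow]
      linear_combination (-thetaB (2 * τ + 1) ^ 4) * this)
  have : c = 1 := tendsto_nhds_unique (tendsto_const_nhds.congr fun τ => (hc τ).symm) hlim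
  rw [← this]; exact hc τ

lemma Theta_ne_zero (τ : ℍ) : Theta τ ≠ 0 := by
  intro h
  have := Theta_pow_mul_etaQuot τ
  simp [h] at this

/-- `f` transforms under `Γ₀(4)` like the `m`-th power of `Theta`. -/
def IsAut (m : ℤ) (f : ℍ → ℂ) : Prop :=
  ∀ γ ∈ Gamma0 4, ∀ τ, f (γ • τ) = (Theta (γ • τ) / Theta τ) ^ m * f τ

lemma isAut_Theta : IsAut 1 Theta := fun γ _ τ => by
  rw [zpow_one, div_mul_cancel₀ _ (Theta_ne_zero τ)]

lemma isAut_R4 : IsAut 4 R4 := fun γ hγ τ => by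
  rw [R4_gamma0 γ hγ τ, show (4 : ℤ) = (4 : ℕ) from rfl, zpow_natCast, div_pow,
    Theta_pow_gamma0 γ hγ τ, mul_div_cancel_right₀ _ (pow_ne_zero _ (Theta_ne_zero τ))]

section IsAut
variable {m n : ℤ} {f g : ℍ → ℂ}

lemma IsAut.mul (hf : IsAut m f) (hg : IsAut n g) : IsAut (m + n) (fun τ => f τ * g τ) :=
  fun γ hγ τ => by
    simp only [hf γ hγ, hg γ hγ]
    rw [zpow_add₀ (div_ne_zero (Theta_ne_zero _) (Theta_ne_zero _))]; ring

lemma IsAut.zpow (hf : IsAut m f) (n : ℤ) : IsAut (m * n) (fun τ => f τ ^ n) :=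
  fun γ hγ τ => by
    simp only [hf γ hγ]
    rw [mul_zpow, _root_.zpow_mul]

lemma IsAut.smul_add (hf : IsAut m f) (hg : IsAut m g) (c : ℂ) :
    IsAut m (fun τ => c * f τ + g τ) := fun γ hγ τ => by
  simp only [hf γ hγ, hg γ hγ]; ring

lemma IsAut.four_iff : IsAut 4 f ↔ ∀ γ ∈ Gamma0 4, ∀ τ, f (γ • τ) = denomC γ τ ^ 2 * f τ := by
  have (γ) (hγ : γ ∈ Gamma0 4) (τ : ℍ) : (Theta (γ • τ) / Theta τ) ^ (4 : ℤ) = denomC γ τ ^ 2 := by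
    rw [show (4 : ℤ) = (4 : ℕ) from rfl, zpow_natCast, div_pow,
      Theta_pow_gamma0 γ hγ τ, mul_div_cancel_right₀ _ (pow_ne_zero _ (Theta_ne_zero τ))]
  constructor
  · intro h γ hγ τ; rw [h γ hγ, this γ hγ]
  · intro h γ hγ τ; rw [h γ hγ, this γ hγ]

lemma sl_eq_zpow_mul (m : ℤ) (f : ℍ → ℂ) (σ : SL(2, ℤ)) (τ : ℍ) :
    sl (m / 2) f σ τ = sl (1 / 2) Theta σ τ ^ m * (f (σ • τ) / Theta (σ • τ) ^ m) := by
  rw [sl_zpow_apply, sl, sl, mul_one_div]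
  have := zpow_ne_zero m (Theta_ne_zero (σ • τ))
  field_simp

lemma IsAut.div_Theta (hf : IsAut m f) {γ : SL(2, ℤ)} (hγ : γ ∈ Gamma0 4) (τ : ℍ) :
    f (γ • τ) / Theta (γ • τ) ^ m = f τ / Theta τ ^ m := by
  have h1 := zpow_ne_zero m (Theta_ne_zero (γ • τ))
  have h2 := zpow_ne_zero m (Theta_ne_zero τ)
  rw [hf γ hγ, div_zpow]; field_simp

lemma sl_ne_zero {k : ℂ} (hf : ∀ τ, f τ ≠ 0) (σ : SL(2, ℤ)) (τ : ℍ) : sl k f σ τ ≠ 0 := by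
  rw [sl]
  refine mul_ne_zero ?_ (hf _)
  rw [Ne, cpow_eq_zero_iff]; simp [denomC_ne_zero]

lemma sl_Theta_pow_four (σ : SL(2, ℤ)) (τ : ℍ) :
    sl (1 / 2) Theta σ τ ^ 4 = (denomC σ τ ^ 2)⁻¹ * Theta (σ • τ) ^ 4 := by
  rw [sl_pow_apply, ← sl_two_apply (fun τ => Theta τ ^ 4)]; norm_num

/-- Slashes by elements of a double coset `Γ₀(4) ρ T^n` agree up to translation and a constant. -/
lemma exists_sl_mul_mul {γ : SL(2, ℤ)} (hγ : γ ∈ Gamma0 4) (ρ : SL(2, ℤ)) (n : ℤ) :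
    ∃ c : ℂ, c ≠ 0 ∧ ∀ (m : ℤ) (f : ℍ → ℂ), IsAut m f → ∀ τ,
      sl (m / 2) f (γ * ρ * ModularGroup.T ^ n) τ =
        c ^ m * sl (m / 2) f ρ (ModularGroup.T ^ n • τ) := by
  set A : ℍ → ℂ := fun τ => sl (1 / 2) Theta (γ * ρ * ModularGroup.T ^ n) τ /
    sl (1 / 2) Theta ρ (ModularGroup.T ^ n • τ) with hA
  have hne (σ : SL(2, ℤ)) (τ : ℍ) : sl (1 / 2) Theta σ τ ≠ 0 := sl_ne_zero Theta_ne_zero σ τ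
  have hA4 (τ : ℍ) : A τ ^ 4 = 1 := by
    rw [hA, div_pow, div_eq_one_iff_eq (pow_ne_zero _ (hne _ _)), sl_Theta_pow_four,
      sl_Theta_pow_four, denomC_mul, denomC_mul, denomC_T_zpow, mul_one, mul_smul, mul_smul,
      Theta_pow_gamma0 γ hγ]
    have h1 := denomC_ne_zero γ (ρ • ModularGroup.T ^ n • τ)
    field_simp
  have hcont : Continuous A :=
    (mdiff_div (mdifferentiable_slash mdifferentiable_Theta _ _)
      ((mdifferentiable_slash mdifferentiable_Theta _ ρ).sl_smul (ModularGroup.T ^ n))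
      fun τ => hne _ _).continuous
  refine ⟨A UpperHalfPlane.I, div_ne_zero (hne _ _) (hne _ _), fun m f hf τ => ?_⟩
  rw [← eq_const_of_pow_eq hcont (by norm_num) hA4 τ, sl_eq_zpow_mul, sl_eq_zpow_mul, mul_smul,
    mul_smul, hf.div_Theta hγ, hA, div_zpow]
  have := zpow_ne_zero m (hne ρ (ModularGroup.T ^ n • τ))
  field_simp

lemma IsAut.sl_S_T_four (hf : IsAut m f) (τ : ℍ) :
    sl (m / 2) f ModularGroup.S (ModularGroup.T ^ (4 : ℤ) • τ) = sl (m / 2) f ModularGroup.S τ := by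
  have h1 : sl (1 / 2) Theta ModularGroup.S (ModularGroup.T ^ (4 : ℤ) • τ) =
      sl (1 / 2) Theta ModularGroup.S τ := by
    rw [sl_Theta_S _ (quarter _) rfl, sl_Theta_S _ (quarter τ) rfl, Theta_of_coe_add_one]
    rw [coe_quarter, coe_quarter, coe_T_zpow_smul]; push_cast; ring
  have h2 : (ModularGroup.S • ModularGroup.T ^ (4 : ℤ) • τ) = matL⁻¹ • ModularGroup.S • τ := by
    simp only [smul_smul]; congr 1; decide +revert
  rw [sl_eq_zpow_mul, sl_eq_zpow_mul, h1, h2, hf.div_Theta]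
  rw [gamma0_four_row]; decide

lemma sl_Theta_matU_T (τ : ℍ) :
    sl (1 / 2) Theta matU (ModularGroup.T • τ) = Complex.I * sl (1 / 2) Theta matU τ := by
  have h : nome (1 / 4) = Complex.I := by
    rw [nome, show 2 * (Real.pi : ℂ) * Complex.I * (1 / 4) = Real.pi / 2 * Complex.I by ring,
      Complex.exp_pi_div_two_mul_I]
  rw [sl_Theta_matU, sl_Theta_matU, coe_T_smul, add_div, nome_add, h,
    show 2 * ((τ : ℂ) + 1) + 1 = 2 * τ + 1 + 2 by ring, thetaB_add_two]
  ring

lemma IsAut.sl_matU_T (hf : IsAut m f) (τ : ℍ) :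
    sl (m / 2) f matU (ModularGroup.T • τ) = Complex.I ^ m * sl (m / 2) f matU τ := by
  have h2 : (matU • ModularGroup.T • τ) = (matU * ModularGroup.T * matU⁻¹) • matU • τ := by
    simp only [smul_smul]; simp
  rw [sl_eq_zpow_mul, sl_eq_zpow_mul, sl_Theta_matU_T, h2, hf.div_Theta, mul_zpow, mul_assoc]
  rw [gamma0_four_row]; decide

lemma IsAut.T_smul (hf : IsAut m f) (τ : ℍ) : f (ModularGroup.T • τ) = f τ := by
  have h : ModularGroup.T ∈ Gamma0 4 := by rw [gamma0_four_row]; decide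
  rw [hf _ h, Theta_of_coe_add_one (coe_T_smul τ), div_self (Theta_ne_zero τ), _root_.one_zpow, one_mul]

lemma IsAut.sl_T_four (hf : IsAut m f) (σ : SL(2, ℤ)) (τ : ℍ) :
    sl (m / 2) f σ (ModularGroup.T ^ (4 : ℤ) • τ) = sl (m / 2) f σ τ := by
  obtain ⟨γ, hγ, ρ, n, hρ, rfl⟩ := exists_cusp_decomp σ
  have h4 (ρ : SL(2, ℤ)) (h : ρ = 1 ∨ ρ = ModularGroup.S ∨ ρ = matU) (τ : ℍ) :
      sl (m / 2) f ρ (ModularGroup.T ^ (4 : ℤ) • τ) = sl (m / 2) f ρ τ := by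
    rcases h with rfl | rfl | rfl
    · have h : ModularGroup.T ^ (4 : ℤ) ∈ Gamma0 4 := by rw [gamma0_four_row]; decide
      have h3 : ModularGroup.T ^ (4 : ℤ) • τ = ModularGroup.T • ModularGroup.T •
          ModularGroup.T • ModularGroup.T • τ := by
        simp only [smul_smul]; rfl
      rw [sl_one_apply, sl_one_apply, h3]
      simp only [hf.T_smul]
    · exact hf.sl_S_T_four τ
    · have h3 : ModularGroup.T ^ (4 : ℤ) • τ = ModularGroup.T • ModularGroup.T •
          ModularGroup.T • ModularGroup.T • τ := by
        simp only [smul_smul]; rfl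
      have h5 : (Complex.I ^ m) ^ 4 = 1 := by
        rw [← zpow_natCast, ← _root_.zpow_mul, mul_comm, _root_.zpow_mul, zpow_natCast, Complex.I_pow_four,
          _root_.one_zpow]
      rw [h3]
      simp only [hf.sl_matU_T]
      linear_combination sl (m / 2) f matU τ * h5
  obtain ⟨c, -, hc⟩ := exists_sl_mul_mul hγ ρ n
  rw [hc m f hf, hc m f hf, ← h4 ρ hρ (ModularGroup.T ^ n • τ), smul_smul, smul_smul,
    ← _root_.zpow_add, ← _root_.zpow_add, add_comm]

end IsAut

/-- Holomorphic functions of period `M` on `ℍ`, bounded at `i∞`. -/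
structure Reg (M : ℕ) (F : ℍ → ℂ) : Prop where
  pos : 0 < M
  holo : MDifferentiable 𝓘(ℂ) 𝓘(ℂ) F
  per : ∀ τ, F (ModularGroup.T ^ (M : ℤ) • τ) = F τ
  bdd : IsBoundedAtImInfty F

lemma mdiff_nome_div (M : ℕ) (s : ℕ) :
    MDifferentiable 𝓘(ℂ) 𝓘(ℂ) (fun τ : ℍ => nome (τ / M) ^ s) :=
  mdifferentiable_comp_of_differentiableAt (F := fun z => nome (z / M) ^ s)
    UpperHalfPlane.mdifferentiable_coe fun τ => by unfold nome; fun_prop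

lemma nome_div_T (M : ℕ) (hM : 0 < M) (τ : ℍ) :
    nome ((ModularGroup.T ^ (M : ℤ) • τ : ℍ) / M) = nome (τ / M) := by
  have : (M : ℂ) ≠ 0 := by exact_mod_cast hM.ne'
  rw [coe_T_zpow_smul, Int.cast_natCast, add_div, div_self this, nome_add_one]

lemma nome_div_eq_qParam (M : ℕ) (z : ℂ) : nome (z / M) = Function.Periodic.qParam (M : ℝ) z := by
  rw [nome, Function.Periodic.qParam]; congr 1; push_cast; ring

namespace Reg
variable {M : ℕ} {F G : ℍ → ℂ}

lemma periodic (h : Reg M F) : Function.Periodic (F ∘ ofComplex) ((M : ℝ) : ℂ) := by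
  intro z
  rcases lt_or_ge 0 z.im with hz | hz
  · have hz' : 0 < (z + ((M : ℝ) : ℂ)).im := by simpa using hz
    simp only [Function.comp_apply]
    rw [ofComplex_apply_of_im_pos hz, ofComplex_apply_of_im_pos hz', ← h.per ⟨z, hz⟩]
    congr 1
    ext
    rw [coe_T_zpow_smul]; simp
  · have hz' : (z + ((M : ℝ) : ℂ)).im ≤ 0 := by simpa using hz
    simp only [Function.comp_apply]
    rw [ofComplex_apply_of_im_nonpos hz, ofComplex_apply_of_im_nonpos hz']

lemma pos' (h : Reg M F) : (0 : ℝ) < (M : ℝ) := by exact_mod_cast h.pos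

/-- The Taylor coefficients in `e^{2πiτ/M}`. -/
def _root_.qc (M : ℕ) (F : ℍ → ℂ) (n : ℕ) : ℂ := PowerSeries.coeff n (qExpansion (M : ℝ) F)

lemma hasSum (h : Reg M F) (τ : ℍ) : HasSum (fun n => qc M F n * nome (τ / M) ^ n) (F τ) := by
  have := hasSum_qExpansion h.pos' h.periodic h.holo h.bdd τ
  simpa only [nome_div_eq_qParam, qc, smul_eq_mul] using this

lemma analyticAt (h : Reg M F) : AnalyticAt ℂ (cuspFunction (M : ℝ) F) 0 :=
  analyticAt_cuspFunction_zero h.pos' h.periodic h.holo h.bdd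

lemma qc_mul (hF : Reg M F) (hG : Reg M G) (n : ℕ) : qc M (fun τ => F τ * G τ) n =
    ∑ p ∈ Finset.HasAntidiagonal.antidiagonal n, qc M F p.1 * qc M G p.2 := by
  have := qExpansion_mul hF.analyticAt hG.analyticAt
  rw [qc, show (fun τ => F τ * G τ) = F * G from rfl, this, PowerSeries.coeff_mul]
  rfl

lemma fCoeff_eq_qc (h : Reg M F) (n : ℕ) : fCoeff M n F = qc M F n := by
  rw [qc, qExpansion_coeff_eq_intervalIntegral h.pos' h.periodic h.holo h.bdd n one_pos, fCoeff]
  push_cast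
  congr 1
  refine intervalIntegral.integral_congr fun x _ => ?_
  simp only [← nome_div_eq_qParam]
  rw [mul_comm, ← nome_nat_mul, one_div, ← nome_neg, nome]
  congr 1
  · congr 1; ring
  · congr 1; ext; simp [hpt]

lemma tendsto (h : Reg M F) : Tendsto F atImInfty (𝓝 (qc M F 0)) := by
  rw [qc, qExpansion_coeff_zero h.pos' h.analyticAt h.periodic]
  have hexp := exp_decay_sub_atImInfty h.pos' h.periodic h.holo h.bdd
  have h0 : Tendsto (fun τ : ℍ => Real.exp (-2 * Real.pi * τ.im / M)) atImInfty (𝓝 0) := by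
    refine Real.tendsto_exp_atBot.comp (Tendsto.atBot_div_const h.pos' ?_)
    exact tendsto_comap.const_mul_atTop_of_neg (by linarith [Real.pi_pos])
  simpa using (hexp.trans_tendsto h0).add_const (valueAtInfty F)

end Reg

lemma fCoeff_shift (M : ℕ) (n s : ℤ) (F : ℍ → ℂ) :
    fCoeff M n F = fCoeff M (n + s) (fun τ => F τ * nome (τ / M) ^ s) := by
  rw [fCoeff, fCoeff]
  congr 1
  refine intervalIntegral.integral_congr fun x _ => ?_
  rw [nome, ← Complex.exp_int_mul, mul_assoc (F _) (Complex.exp _), ← Complex.exp_add]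
  congr 2
  simp only [hpt]
  push_cast; ring

lemma hasSum_of_shift (s : ℕ) (g : ℤ → ℂ) (hg : ∀ n, n < -(s : ℤ) → g n = 0) {a : ℂ}
    (h : HasSum (fun m : ℕ => g (m - s)) a) : HasSum g a := by
  have hinj : Function.Injective (fun m : ℕ => (m : ℤ) - s) := fun a b hab => by
    simp only at hab; omega
  refine (hinj.hasSum_iff fun n hn => hg n ?_).1 h
  by_contra hc
  exact hn ⟨(n + s).toNat, by simp only; omega⟩

/-- The Laurent coefficients of `F`, when `F·e^{2πisτ/M}` is regular. -/
def laurentC (M s : ℕ) (F : ℍ → ℂ) (n : ℤ) : ℂ :=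
  if n < -(s : ℤ) then 0 else qc M (fun τ => F τ * nome (τ / M) ^ s) (n + s).toNat

lemma laurentC_shift (M s : ℕ) (F : ℍ → ℂ) (m : ℕ) :
    laurentC M s F (m - s) = qc M (fun τ => F τ * nome (τ / M) ^ s) m := by
  rw [laurentC, if_neg (by omega)]; simp

lemma exp_eq_nome (M : ℕ) (n : ℤ) (τ : ℂ) :
    Complex.exp (2 * Real.pi * Complex.I * n * τ / M) = nome (τ / M) ^ n := by
  rw [nome, ← Complex.exp_int_mul]; congr 1; ring

lemma laurent_term (M s : ℕ) (F : ℍ → ℂ) (m : ℕ) (τ : ℍ) :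
    laurentC M s F (m - s) * nome (τ / M) ^ ((m : ℤ) - s) =
      qc M (fun τ => F τ * nome (τ / M) ^ s) m * nome (τ / M) ^ m * (nome (τ / M) ^ s)⁻¹ := by
  rw [laurentC_shift, zpow_sub₀ (nome_ne_zero _), zpow_natCast, zpow_natCast]; ring

lemma norm_nome_zpow (M : ℕ) (n : ℤ) (τ : ℍ) :
    ‖nome (τ / M) ^ n‖ = Real.exp (-2 * Real.pi * (τ.im / M)) ^ n := by
  rw [norm_zpow, norm_nome]
  simp

lemma cuspExpansion_of_reg {k : ℂ} {f : ℍ → ℂ} {σ : SL(2, ℤ)} {M : ℕ} (s : ℕ)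
    (h : Reg M (fun τ => sl k f σ τ * nome (τ / M) ^ s)) :
    CuspExpansion k f σ M (laurentC M s (sl k f σ)) := by
  set c := laurentC M s (sl k f σ) with hc
  have hc0 (n : ℤ) (hn : n < -(s : ℤ)) : c n = 0 := by rw [hc, laurentC, if_pos hn]
  have hsum (τ : ℍ) : HasSum (fun n : ℤ => c n * nome (τ / M) ^ n) (sl k f σ τ) := by
    refine hasSum_of_shift s _ (fun n hn => by rw [hc0 n hn, zero_mul]) ?_
    simp only [hc, laurent_term]
    have := (h.hasSum τ).mul_right (nome (τ / M) ^ s)⁻¹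
    rwa [mul_inv_cancel_right₀ (pow_ne_zero _ (nome_ne_zero _))] at this
  have hnsum (τ : ℍ) : Summable (fun n : ℤ => ‖c n * nome (τ / M) ^ n‖) := (hsum τ).summable.norm
  refine ⟨h.pos, ⟨-s, hc0⟩, fun y₀ hy => ⟨fun τ _ => ?_, ?_⟩⟩
  · simpa only [exp_eq_nome] using hnsum τ
  · simp only [exp_eq_nome]
    change TendstoUniformlyOn _ (sl k f σ) _ _
    set N : Finset ℤ := Finset.Ico (-(s : ℤ)) 0 with hN
    set c' : ℤ → ℂ := fun n => if n < 0 then 0 else c n with hc'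
    set P : ℍ → ℂ := fun τ => ∑ n ∈ N, c n * nome (τ / M) ^ n with hP
    have hsplit (S : Finset ℤ) (hS : N ⊆ S) (τ : ℍ) :
        ∑ n ∈ S, c n * nome (τ / M) ^ n = ∑ n ∈ S, c' n * nome (τ / M) ^ n + P τ := by
      rw [hP]
      simp only
      rw [← Finset.sum_sdiff hS, ← Finset.sum_sdiff hS (f := fun n => c' n * nome (τ / M) ^ n)]
      have h1 : ∑ n ∈ N, c' n * nome (τ / M) ^ n = 0 :=
        Finset.sum_eq_zero fun n hn => by
          rw [hc']; simp only; rw [if_pos (Finset.mem_Ico.1 hn).2, zero_mul]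
      rw [h1, add_zero]
      congr 1
      refine Finset.sum_congr rfl fun n hn => ?_
      rw [hc']; simp only
      split_ifs with hneg
      · rw [hc0 n (by
          by_contra hcon
          exact (Finset.mem_sdiff.1 hn).2 (Finset.mem_Ico.2 ⟨by omega, hneg⟩))]
      · rfl
    have hy' : 0 < ((y₀ : ℂ) * Complex.I).im := by simpa using hy
    have hu : Summable (fun n : ℤ => ‖c n‖ * Real.exp (-2 * Real.pi * (y₀ / M)) ^ n) := by
      have := hnsum ⟨_, hy'⟩
      refine this.congr fun n => ?_
      rw [norm_mul, norm_nome_zpow]; simp [UpperHalfPlane.im]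
    have hbound (n : ℤ) (τ : ℍ) (hτ : τ ∈ {τ : ℍ | y₀ ≤ τ.im}) :
        ‖c' n * nome (τ / M) ^ n‖ ≤ ‖c n‖ * Real.exp (-2 * Real.pi * (y₀ / M)) ^ n := by
      rw [hc']; simp only
      split_ifs with hneg
      · rw [zero_mul, norm_zero]; positivity
      · rw [norm_mul, norm_nome_zpow]
        refine mul_le_mul_of_nonneg_left ?_ (norm_nonneg _)
        lift n to ℕ using not_lt.1 hneg
        rw [zpow_natCast, zpow_natCast]
        refine pow_le_pow_left₀ (Real.exp_nonneg _) (Real.exp_le_exp.2 ?_) _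
        have h1 : y₀ / M ≤ τ.im / M := div_le_div_of_nonneg_right hτ h.pos'.le
        nlinarith [Real.pi_pos]
    have huni := tendstoUniformlyOn_tsum hu hbound
    have hval (τ : ℍ) : ∑' n, c' n * nome (τ / M) ^ n = sl k f σ τ - P τ := by
      have h1 : HasSum (fun n => c n * nome (τ / M) ^ n - c' n * nome (τ / M) ^ n) (P τ) := by
        have : ∀ n ∉ N, c n * nome (τ / M) ^ n - c' n * nome (τ / M) ^ n = 0 := by
          intro n hn
          rw [hc']; simp only
          split_ifs with hneg
          · rw [hc0 n (by
              by_contra hcon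
              exact hn (Finset.mem_Ico.2 ⟨by omega, hneg⟩))]; simp
          · simp
        have h2 : HasSum _ (∑ n ∈ N, (c n * nome (τ / M) ^ n - c' n * nome (τ / M) ^ n)) :=
          hasSum_sum_of_ne_finset_zero this
        convert h2 using 1
        rw [hP]
        refine Finset.sum_congr rfl fun n hn => ?_
        rw [hc']; simp only
        rw [if_pos (Finset.mem_Ico.1 hn).2]; simp
      have h3 := (hsum τ).sub h1
      simp only [sub_sub_cancel] at h3
      exact h3.tsum_eq
    rw [Metric.tendstoUniformlyOn_iff] at huni ⊢
    intro ε hε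
    filter_upwards [huni ε hε, Filter.eventually_ge_atTop N] with S hS hNS τ hτ
    have := hS τ hτ
    rw [hval, dist_eq_norm] at this
    rw [hsplit S hNS, dist_eq_norm]
    convert this using 2
    ring

lemma isBounded_of_cuspExpansion {k : ℂ} {f : ℍ → ℂ} {σ : SL(2, ℤ)} {M : ℕ} {c : ℤ → ℂ}
    (h : CuspExpansion k f σ M c) (hc : ∀ n, n < 0 → c n = 0) :
    IsBoundedAtImInfty (sl k f σ) := by
  obtain ⟨hM, -, h⟩ := h
  have h2 := (h 1 one_pos).2
  simp only [exp_eq_nome] at h2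
  obtain ⟨S, hS⟩ := ((Metric.tendstoUniformlyOn_iff.1 h2) 1 one_pos).exists
  refine isBoundedAtImInfty_iff.2 ⟨1 + ∑ n ∈ S, ‖c n‖, 1, fun τ hτ => ?_⟩
  have h3 := hS τ hτ
  rw [dist_eq_norm] at h3
  have h4 : ‖∑ n ∈ S, c n * nome (τ / M) ^ n‖ ≤ ∑ n ∈ S, ‖c n‖ := by
    refine norm_sum_le_of_le _ fun n _ => ?_
    rcases lt_or_ge n 0 with hn | hn
    · rw [hc n hn]; simp
    · lift n to ℕ using hn
      rw [norm_mul, zpow_natCast, norm_pow]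
      refine mul_le_of_le_one_right (norm_nonneg _) (pow_le_one₀ (norm_nonneg _) ?_)
      refine (norm_nome_lt_one ?_).le
      have := τ.im_pos
      have hM' : (0 : ℝ) < M := by exact_mod_cast hM
      simp only [Complex.div_natCast_im, UpperHalfPlane.coe_im]
      positivity
  have h5 : ‖sl k f σ τ‖ ≤ ‖sl k f σ τ - ∑ n ∈ S, c n * nome (τ / M) ^ n‖ +
      ‖∑ n ∈ S, c n * nome (τ / M) ^ n‖ := norm_le_norm_sub_add _ _
  have h6 : ‖sl k f σ τ - ∑ n ∈ S, c n * nome (τ / M) ^ n‖ < 1 := h3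
  linarith

lemma IsBounded.congr {f g : ℍ → ℂ} (hf : IsBoundedAtImInfty f) (h : ∀ τ, g τ = f τ) :
    IsBoundedAtImInfty g := (funext h : g = f) ▸ hf

lemma IsBounded.mul {f g h : ℍ → ℂ} (hf : IsBoundedAtImInfty f) (hg : IsBoundedAtImInfty g)
    (e : ∀ τ, h τ = f τ * g τ) : IsBoundedAtImInfty h :=
  IsBounded.congr (Filter.BoundedAtFilter.mul hf hg) e

lemma IsBounded.smul_add {f g h : ℍ → ℂ} {c : ℂ} (hf : IsBoundedAtImInfty f)
    (hg : IsBoundedAtImInfty g) (e : ∀ τ, h τ = c * f τ + g τ) : IsBoundedAtImInfty h :=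
  IsBounded.congr ((Asymptotics.IsBigO.const_mul_left hf c).add hg) e

lemma IsBounded.const (c : ℂ) : IsBoundedAtImInfty (fun _ => c) :=
  Asymptotics.isBigO_const_const _ one_ne_zero _

/-- Holomorphic functions of weight `m/2` on `Γ₀(4)`, regular at the cusps `0` and `1/2`, and
with a pole of order at most `s` at `∞`. -/
structure Form (m s : ℤ) (f : ℍ → ℂ) : Prop where
  holo : MDifferentiable 𝓘(ℂ) 𝓘(ℂ) f
  aut : IsAut m f
  inf : IsBoundedAtImInfty (fun τ : ℍ => f τ * nome τ ^ s)
  zero : IsBoundedAtImInfty (sl (m / 2) f ModularGroup.S)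
  half : IsBoundedAtImInfty (sl (m / 2) f matU)

lemma isBounded_nome_zpow {s : ℤ} (hs : 0 ≤ s) : IsBoundedAtImInfty (fun τ : ℍ => nome τ ^ s) := by
  lift s to ℕ using hs
  simp only [zpow_natCast]
  have := tendsto_nome one_pos 0
  simp only [ofReal_one, one_mul, add_zero] at this
  exact isBounded_of_tendsto (this.pow s)

lemma mdifferentiable_nome_zpow (s : ℤ) :
    MDifferentiable 𝓘(ℂ) 𝓘(ℂ) (fun τ : ℍ => nome τ ^ s) :=
  mdifferentiable_comp_of_differentiableAt (F := fun z => nome z ^ s)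
    UpperHalfPlane.mdifferentiable_coe fun _ => (differentiableAt_nome _).zpow (.inl (nome_ne_zero _))

namespace Form
variable {m n s t : ℤ} {f g : ℍ → ℂ}

lemma mono (h : Form m s f) (hst : s ≤ t) : Form m t f where
  __ := h
  inf := by
    refine IsBounded.mul h.inf (isBounded_nome_zpow (sub_nonneg.2 hst)) fun τ => ?_
    rw [mul_assoc, ← zpow_add₀ (nome_ne_zero _), add_sub_cancel]

lemma mul (hf : Form m s f) (hg : Form n t g) : Form (m + n) (s + t) (fun τ => f τ * g τ) where
  holo := mdiff_mul hf.holo hg.holo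
  aut := hf.aut.mul hg.aut
  inf := by
    refine IsBounded.mul hf.inf hg.inf fun τ => ?_
    rw [zpow_add₀ (nome_ne_zero _)]; ring
  zero := by
    refine IsBounded.mul hf.zero hg.zero fun τ => ?_
    rw [sl_mul_apply, ← add_div, ← Int.cast_add]
  half := by
    refine IsBounded.mul hf.half hg.half fun τ => ?_
    rw [sl_mul_apply, ← add_div, ← Int.cast_add]

lemma _root_.sl_smul_add (k : ℂ) (f g : ℍ → ℂ) (c : ℂ) (σ : SL(2, ℤ)) (τ : ℍ) :
    sl k (fun τ => c * f τ + g τ) σ τ = c * sl k f σ τ + sl k g σ τ := by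
  simp only [sl]; ring

lemma smul_add (hf : Form m s f) (hg : Form m s g) (c : ℂ) :
    Form m s (fun τ => c * f τ + g τ) where
  holo := by
    have h := mdiff_mul (mdifferentiable_const (c := c)) hf.holo
    have h2 := hg.holo
    rw [UpperHalfPlane.mdifferentiable_iff] at *
    exact h.add h2
  aut := hf.aut.smul_add hg.aut c
  inf := IsBounded.smul_add (c := c) hf.inf hg.inf fun τ => by ring
  zero := IsBounded.smul_add hf.zero hg.zero fun τ => sl_smul_add _ _ _ _ _ _
  half := IsBounded.smul_add hf.half hg.half fun τ => sl_smul_add _ _ _ _ _ _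

lemma const (c : ℂ) : Form 0 0 (fun _ => c) where
  holo := mdifferentiable_const
  aut _ _ _ := by simp
  inf := by
    simp only [_root_.zpow_zero, mul_one]
    exact IsBounded.const c
  zero := IsBounded.congr (IsBounded.const c) fun τ => by simp [sl]
  half := IsBounded.congr (IsBounded.const c) fun τ => by simp [sl]

lemma pow (hf : Form m s f) (n : ℕ) : Form (n * m) (n * s) (fun τ => f τ ^ n) := by
  induction n with
  | zero => simpa using const 1
  | succ n ih =>
    simp only [pow_succ]
    convert ih.mul hf using 1 <;> push_cast <;> ring

lemma _root_.tendsto_R4_mul : Tendsto (fun τ : ℍ => R4 τ * nome τ ^ (-1 : ℤ)) atImInfty (𝓝 1) := by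
  have h := ((tendsto_eulerP_nome_nat (m := 4) (by norm_num)).pow 8).div
    ((tendsto_eulerP_nome_nat (m := 2) (by norm_num)).pow 4) (by norm_num)
  have h2 : (1 : ℂ) ^ 8 / 1 ^ 4 = 1 := by norm_num
  rw [h2] at h
  refine h.congr fun τ => ?_
  have := nome_ne_zero τ
  rw [R4_eq_eulerP]
  simp only [Pi.div_apply, Nat.cast_ofNat, _root_.zpow_neg, _root_.zpow_one]
  field_simp

lemma _root_.tendsto_sl_R4_S : Tendsto (sl 2 R4 ModularGroup.S) atImInfty (𝓝 (-1 / 64)) := by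
  have h := ((tendsto_eulerP_nome (a := 1 / 4) (by norm_num) 0).pow 8).div
    ((tendsto_eulerP_nome (a := 1 / 2) (by norm_num) 0).pow 4) (by norm_num)
  have h2 : (1 : ℂ) ^ 8 / 1 ^ 4 = 1 := by norm_num
  rw [h2] at h
  have h3 := h.const_mul (-1 / 64 : ℂ)
  rw [mul_one] at h3
  refine h3.congr fun τ => ?_
  rw [sl_R4_S]
  simp only [Pi.div_apply]
  push_cast
  simp only [add_zero, one_div, inv_mul_eq_div]

lemma _root_.tendsto_sl_R4_matU : Tendsto (sl 2 R4 matU) atImInfty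
    (𝓝 (-nome (1 / 6) ^ 2 * nome (1 / 6) / 16)) := by
  have h := ((tendsto_eulerP_nome (a := 1) (by norm_num) (1 / 2)).pow 8).div
    ((tendsto_eulerP_nome (a := 2) (by norm_num) 0).pow 4) (by norm_num)
  have h2 : (1 : ℂ) ^ 8 / 1 ^ 4 = 1 := by norm_num
  rw [h2] at h
  have h3 := h.const_mul (-nome (1 / 6) ^ 2 * nome (1 / 6) / 16)
  rw [mul_one] at h3
  refine h3.congr fun τ => ?_
  rw [sl_R4_matU]
  simp only [Pi.div_apply]
  push_cast
  simp only [add_zero, one_mul]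

lemma _root_.form_R4 : Form 4 (-1) R4 where
  holo := mdifferentiable_R4
  aut := isAut_R4
  inf := isBounded_of_tendsto tendsto_R4_mul
  zero := by
    rw [show ((4 : ℤ) : ℂ) / 2 = 2 by norm_num]
    exact isBounded_of_tendsto tendsto_sl_R4_S
  half := by
    rw [show ((4 : ℤ) : ℂ) / 2 = 2 by norm_num]
    exact isBounded_of_tendsto tendsto_sl_R4_matU

lemma _root_.form_R4_inv : Form (-4) 1 (fun τ => (R4 τ)⁻¹) where
  holo := mdiff_inv mdifferentiable_R4 R4_ne_zero
  aut := by simpa using isAut_R4.zpow (-1)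
  inf := by
    refine isBounded_of_tendsto ((tendsto_R4_mul.inv₀ one_ne_zero).congr fun τ => ?_)
    rw [mul_inv, ← _root_.zpow_neg, neg_neg]
  zero := by
    refine isBounded_of_tendsto ((tendsto_sl_R4_S.inv₀ (by norm_num)).congr fun τ => ?_)
    rw [sl_inv_apply]; norm_num
  half := by
    refine isBounded_of_tendsto ((tendsto_sl_R4_matU.inv₀ ?_).congr fun τ => ?_)
    · have := nome_ne_zero (1 / 6)
      exact div_ne_zero (mul_ne_zero (neg_ne_zero.2 (pow_ne_zero _ this)) this) (by norm_num)
    · rw [sl_inv_apply]; norm_num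

lemma _root_.form_Theta : Form 1 0 Theta where
  holo := mdifferentiable_Theta
  aut := isAut_Theta
  inf := by simpa using isBounded_of_tendsto tendsto_Theta
  zero := by
    refine isBounded_of_tendsto (((tendsto_Theta.comp tendsto_quarter).const_mul
      ((-((1 / 2 : ℝ) : ℂ) * Complex.I) ^ (1 / 2 : ℂ))).congr fun τ => ?_)
    rw [Int.cast_one, sl_Theta_S τ (quarter τ) rfl]; rfl
  half := by
    have h1 := isBounded_of_tendsto (tendsto_nome (a := 1 / 4) (by norm_num) 0)
    refine IsBounded.mul (IsBounded.mul (IsBounded.const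
      ((-((1 : ℝ) : ℂ) * Complex.I) ^ (1 / 2 : ℂ) * nome (1 / 8))) h1 fun τ => rfl)
      isBounded_thetaB fun τ => ?_
    rw [Int.cast_one, sl_Theta_matU]
    push_cast
    rw [add_zero, one_div_mul_eq_div]

lemma reg_inf (h : Form m s f) : Reg 1 (fun τ : ℍ => f τ * nome τ ^ s) where
  pos := one_pos
  holo := mdiff_mul h.holo (mdifferentiable_nome_zpow s)
  per τ := by
    simp only [Nat.cast_one, _root_.zpow_one, h.aut.T_smul, coe_T_smul, nome_add_one]
  bdd := h.inf

lemma reg_zero (h : Form m s f) : Reg 4 (sl (m / 2) f ModularGroup.S) where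
  pos := by norm_num
  holo := mdifferentiable_slash h.holo _ _
  per τ := h.aut.sl_T_four _ τ
  bdd := h.zero

lemma bounded_sl {s : ℕ} (h : Form m s f) (σ : SL(2, ℤ)) :
    IsBoundedAtImInfty (fun τ : ℍ => sl (m / 2) f σ τ * nome τ ^ s) := by
  obtain ⟨γ, hγ, ρ, n, hρ, rfl⟩ := exists_cusp_decomp σ
  obtain ⟨c, -, hc⟩ := exists_sl_mul_mul hγ ρ n
  have hn := isBounded_nome_zpow (Int.natCast_nonneg s)
  simp only [zpow_natCast] at hn
  have hb : IsBoundedAtImInfty (fun τ : ℍ => sl (m / 2) f ρ τ * nome τ ^ s) := by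
    rcases hρ with rfl | rfl | rfl
    · simpa only [sl_one_apply, zpow_natCast] using h.inf
    · exact IsBounded.mul h.zero hn fun _ => rfl
    · exact IsBounded.mul h.half hn fun _ => rfl
  have hT : IsBoundedAtImInfty (fun τ : ℍ => sl (m / 2) f ρ (ModularGroup.T ^ n • τ) *
      nome (ModularGroup.T ^ n • τ : ℍ) ^ s) :=
    Asymptotics.IsBigO.comp_tendsto (k := fun τ : ℍ => ModularGroup.T ^ n • τ) hb
      (tendsto_T_zpow_smul n)
  refine IsBounded.mul (IsBounded.const (c ^ m)) hT fun τ => ?_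
  have hper : nome (ModularGroup.T ^ n • τ : ℍ) = nome τ := by
    rw [coe_T_zpow_smul, nome_add, nome, nome, show 2 * (Real.pi : ℂ) * Complex.I * n =
      n * (2 * Real.pi * Complex.I) by ring, Complex.exp_int_mul_two_pi_mul_I, mul_one]
  simp only [hc m f h.aut, hper]
  ring

lemma cuspExpansion {s : ℕ} (h : Form m s f) (σ : SL(2, ℤ)) :
    CuspExpansion (m / 2) f σ 4 (laurentC 4 (4 * s) (sl (m / 2) f σ)) := by
  have hn (τ : ℍ) : nome (τ / (4 : ℕ)) ^ (4 * s) = nome τ ^ s := by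
    rw [pow_mul, ← nome_nat_mul]
    congr 2
    push_cast; ring
  refine cuspExpansion_of_reg _ ⟨by norm_num, mdiff_mul (mdifferentiable_slash h.holo _ _)
    (mdiff_nome_div _ _), fun τ => ?_, ?_⟩
  · simp only [nome_div_T 4 (by norm_num)]
    congr 1
    exact h.aut.sl_T_four σ τ
  · simp only [hn]
    exact h.bounded_sl σ

lemma isWeaklyHolo {lam : ℤ} {s : ℕ} (h : Form (2 * lam + 1) s f) : IsWeaklyHolo 1 lam f where
  holo := h.holo
  transf := h.aut
  cusp σ := ⟨4, _, by
    have := h.cuspExpansion σ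
    rwa [show (((2 * lam + 1 : ℤ) : ℂ) / 2) = lam + 1 / 2 by push_cast; ring] at this⟩

lemma _root_.isHoloForm_iff {lam : ℤ} : IsHoloForm 1 lam f ↔ Form (2 * lam + 1) 0 f := by
  have hk : (((2 * lam + 1 : ℤ) : ℂ) / 2) = lam + 1 / 2 := by push_cast; ring
  constructor
  · intro h
    have hb (σ : SL(2, ℤ)) : IsBoundedAtImInfty (sl (lam + 1 / 2) f σ) := by
      obtain ⟨M, c, h1, h2⟩ := h.cusp σ
      exact isBounded_of_cuspExpansion h1 h2
    rw [← hk] at hb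
    refine ⟨h.holo, h.transf, ?_, hb _, hb _⟩
    exact IsBounded.congr (hb 1) fun τ => by rw [sl_one_apply]; simp
  · intro h
    refine ⟨h.holo, h.aut, fun σ =>
      ⟨4, laurentC 4 (4 * 0) (sl ((2 * lam + 1 : ℤ) / 2) f σ), ?_, ?_⟩⟩
    · rw [← hk]
      exact cuspExpansion (s := 0) h σ
    · intro n hn
      rw [laurentC, if_pos (by simpa using hn)]

end Form

lemma cayley_mem_ball {z : ℂ} (hz : 0 < z.im) : (z - Complex.I) / (z + Complex.I) ∈ Metric.ball (0 : ℂ) 1 := by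
  have h : z + Complex.I ≠ 0 := fun h => by
    have := congrArg Complex.im h
    simp at this; linarith
  rw [mem_ball_zero_iff, norm_div, div_lt_one (norm_pos_iff.2 h), ← abs_norm, ← abs_norm (z + _),
    ← sq_lt_sq, Complex.sq_norm, Complex.sq_norm, Complex.normSq_apply, Complex.normSq_apply]
  simp
  nlinarith

lemma cayley_inv_im_pos {w : ℂ} (hw : w ∈ Metric.ball (0 : ℂ) 1) :
    w ≠ 1 ∧ 0 < (Complex.I * (1 + w) / (1 - w)).im := by
  rw [mem_ball_zero_iff] at hw
  have h1 : w ≠ 1 := fun h => by simp [h] at hw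
  have h2 : 0 < Complex.normSq (1 - w) := Complex.normSq_pos.2 (sub_ne_zero.2 h1.symm)
  have h3 : ‖w‖ ^ 2 < 1 := by nlinarith [norm_nonneg w]
  rw [Complex.sq_norm, Complex.normSq_apply] at h3
  refine ⟨h1, ?_⟩
  rw [Complex.div_im]
  simp only [Complex.mul_im, Complex.mul_re, Complex.I_re, Complex.I_im, Complex.add_re,
    Complex.add_im, Complex.sub_re, Complex.sub_im, Complex.one_re, Complex.one_im]
  rw [← sub_div]
  refine div_pos ?_ h2
  nlinarith

/-- Holomorphic functions on `ℍ` have primitives. -/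
lemma exists_primitive {F : ℍ → ℂ} (hF : MDifferentiable 𝓘(ℂ) 𝓘(ℂ) F) :
    ∃ H : ℂ → ℂ, ∀ τ : ℍ, HasDerivAt H (F τ) τ := by
  set φ : ℂ → ℂ := fun w => Complex.I * (1 + w) / (1 - w) with hφ
  have hF' := UpperHalfPlane.mdifferentiable_iff.1 hF
  have hd : DifferentiableOn ℂ (fun w => (F ∘ ofComplex) (φ w) * (2 * Complex.I / (1 - w) ^ 2))
      (Metric.ball 0 1) := by
    intro w hw
    obtain ⟨h1, h2⟩ := cayley_inv_im_pos hw
    have h1' : 1 - w ≠ 0 := sub_ne_zero.2 h1.symm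
    have hφd : DifferentiableAt ℂ φ w := by
      rw [hφ]
      exact DifferentiableAt.div (by fun_prop) (by fun_prop) h1'
    have hFd := (hF' (φ w) h2).differentiableAt (isOpen_upperHalfPlaneSet.mem_nhds h2)
    refine (DifferentiableAt.mul (hFd.comp w hφd) ?_).differentiableWithinAt
    exact DifferentiableAt.div (by fun_prop) (by fun_prop) (pow_ne_zero _ h1')
  obtain ⟨P, hP⟩ := hd.isExactOn_ball
  refine ⟨fun z => P ((z - Complex.I) / (z + Complex.I)), fun τ => ?_⟩
  have h : (τ : ℂ) + Complex.I ≠ 0 := fun h => by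
    have := congrArg Complex.im h
    have h2 := τ.im_pos
    simp at this; linarith
  have hψ : HasDerivAt (fun z : ℂ => (z - Complex.I) / (z + Complex.I))
      ((1 * ((τ : ℂ) + Complex.I) - (τ - Complex.I) * 1) / ((τ : ℂ) + Complex.I) ^ 2) τ :=
    ((hasDerivAt_id _).sub_const _).div ((hasDerivAt_id _).add_const _) h
  have := (hP _ (cayley_mem_ball τ.im_pos)).comp (τ : ℂ) hψ
  refine this.congr_deriv ?_
  have h3 : 1 - ((τ : ℂ) - Complex.I) / (τ + Complex.I) = 2 * Complex.I / (τ + Complex.I) := by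
    field_simp; ring
  have h4 : φ (((τ : ℂ) - Complex.I) / (τ + Complex.I)) = τ := by
    rw [hφ]
    simp only
    rw [h3]
    field_simp
    ring
  beta_reduce
  rw [h4, h3]
  simp only [Function.comp_apply, ofComplex_apply]
  field_simp
  ring

section Primitive
variable {F : ℍ → ℂ} {H : ℂ → ℂ}

lemma hasDerivAt_primitive_sl (hH : ∀ τ : ℍ, HasDerivAt H (F τ) τ) (σ : SL(2, ℤ)) (τ : ℍ) :
    HasDerivAt (fun z : ℂ => H (((σ 0 0 : ℂ) * z + (σ 0 1 : ℂ)) / ((σ 1 0 : ℂ) * z + (σ 1 1 : ℂ))))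
      (sl 2 F σ τ) τ := by
  have h := denomC_ne_zero σ τ
  have hdet : (σ 0 0 : ℂ) * σ 1 1 - σ 0 1 * σ 1 0 = 1 := by exact_mod_cast sl_det σ
  have h1 : HasDerivAt (fun z : ℂ => ((σ 0 0 : ℂ) * z + (σ 0 1 : ℂ)) / ((σ 1 0 : ℂ) * z + (σ 1 1 : ℂ)))
      (((σ 0 0 : ℂ) * 1 * denomC σ τ - ((σ 0 0 : ℂ) * τ + (σ 0 1 : ℂ)) * ((σ 1 0 : ℂ) * 1)) /
        denomC σ τ ^ 2) τ :=
    (((hasDerivAt_id _).const_mul _).add_const _).div (((hasDerivAt_id _).const_mul _).add_const _) h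
  have h2 := hH (σ • τ)
  rw [coe_sl_smul, denomC] at h2
  refine (HasDerivAt.comp (τ : ℂ) h2 h1).congr_deriv ?_
  rw [sl_two_apply, mul_comm]
  congr 1
  rw [div_eq_iff (pow_ne_zero _ h), inv_mul_cancel₀ (pow_ne_zero _ h), denomC]
  linear_combination hdet

lemma exists_period (hH : ∀ τ : ℍ, HasDerivAt H (F τ) τ) {γ : SL(2, ℤ)}
    (hγ : ∀ τ, F (γ • τ) = denomC γ τ ^ 2 * F τ) : ∃ C, ∀ τ : ℍ, H (γ • τ : ℍ) - H τ = C := by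
  have hd (τ : ℍ) : HasDerivAt (fun z : ℂ =>
      H (((γ 0 0 : ℂ) * z + (γ 0 1 : ℂ)) / ((γ 1 0 : ℂ) * z + (γ 1 1 : ℂ))) - H z) 0 τ := by
    have := (hasDerivAt_primitive_sl hH γ τ).sub (hH τ)
    rwa [sl_two_apply, hγ, inv_mul_cancel_left₀ (pow_ne_zero _ (denomC_ne_zero γ τ)), sub_self]
      at this
  obtain ⟨C, hC⟩ := isOpen_upperHalfPlaneSet.exists_is_const_of_deriv_eq_zero
    (convex_halfSpace_im_gt 0).isPreconnected
    (fun z hz => (hd ⟨z, hz⟩).differentiableAt.differentiableWithinAt)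
    (fun z hz => (hd ⟨z, hz⟩).deriv)
  refine ⟨C, fun τ => ?_⟩
  rw [coe_sl_smul, ← hC τ τ.im_pos, denomC]

lemma primitive_sub_eq_integral (hF : MDifferentiable 𝓘(ℂ) 𝓘(ℂ) F)
    (hH : ∀ τ : ℍ, HasDerivAt H (F τ) τ) (σ : SL(2, ℤ)) (n : ℕ) (τ : ℍ) :
    H (σ • ModularGroup.T ^ (n : ℤ) • τ : ℍ) - H (σ • τ : ℍ) =
      ∫ x in (0 : ℝ)..n, sl 2 F σ (x +ᵥ τ) := by
  have hd (x : ℝ) : HasDerivAt (fun x : ℝ => H (σ • (x +ᵥ τ) : ℍ)) (sl 2 F σ (x +ᵥ τ)) x := by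
    have h1 := hasDerivAt_primitive_sl hH σ (x +ᵥ τ)
    have h2 : HasDerivAt (fun x : ℝ => (x : ℂ) + τ) 1 x :=
      (Complex.ofRealCLM.hasDerivAt).add_const _
    rw [coe_vadd] at h1
    have h3 := HasDerivAt.comp x h1 h2
    rw [mul_one] at h3
    refine h3.congr_of_eventuallyEq (Eventually.of_forall fun y => ?_)
    simp only [Function.comp_apply]
    rw [coe_sl_smul, denomC, coe_vadd]
  have hcont : Continuous (fun x : ℝ => sl 2 F σ (x +ᵥ τ)) := by
    refine (mdifferentiable_slash hF 2 σ).continuous.comp ?_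
    rw [UpperHalfPlane.isEmbedding_coe.continuous_iff]
    simp only [Function.comp_def, coe_vadd]
    fun_prop
  rw [intervalIntegral.integral_eq_sub_of_hasDerivAt (fun x _ => hd x)
    (hcont.intervalIntegrable _ _)]
  congr 4
  · ext; rw [coe_T_zpow_smul, coe_vadd]; push_cast; ring
  · simp

end Primitive

lemma hpt_eq_vadd (x : ℝ) : hpt x = x +ᵥ UpperHalfPlane.I := by
  ext; rw [coe_vadd]; rfl

lemma integral_eq_fCoeff {M : ℕ} (hM : 0 < M) (G : ℍ → ℂ) :
    ∫ x in (0 : ℝ)..M, G (x +ᵥ UpperHalfPlane.I) = M * fCoeff M 0 G := by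
  have : (M : ℂ) ≠ 0 := by exact_mod_cast hM.ne'
  rw [fCoeff, ← mul_assoc, mul_one_div_cancel this, one_mul]
  simp [hpt_eq_vadd]

/-- The residue theorem for weight `2` on `Γ₀(4)`. -/
lemma Form.fCoeff_add_c0Coeff {F : ℍ → ℂ} {s : ℤ} (hF : Form 4 s F)
    (hU : Tendsto (sl 2 F matU) atImInfty (𝓝 0)) : fCoeff 1 0 F + 4 * c0Coeff 2 F = 0 := by
  obtain ⟨H, hH⟩ := exists_primitive hF.holo
  have hper (γ : SL(2, ℤ)) (hγ : γ ∈ Gamma0 4) := exists_period hH (IsAut.four_iff.1 hF.aut γ hγ)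
  obtain ⟨A, hA⟩ := hper ModularGroup.T (by rw [gamma0_four_row]; decide)
  obtain ⟨B, hB⟩ := hper matL⁻¹ (by rw [gamma0_four_row]; decide)
  obtain ⟨P, hP⟩ := hper (matU * ModularGroup.T * matU⁻¹) (by rw [gamma0_four_row]; decide)
  have hA' : A = fCoeff 1 0 F := by
    have h := primitive_sub_eq_integral hF.holo hH 1 1 UpperHalfPlane.I
    rw [integral_eq_fCoeff one_pos] at h
    simp only [one_smul, Nat.cast_one, _root_.zpow_one, one_mul] at h
    rw [← hA UpperHalfPlane.I, h]
    congr 1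
    funext τ; rw [sl_one_apply]
  have hB' : B = 4 * c0Coeff 2 F := by
    have h := primitive_sub_eq_integral hF.holo hH ModularGroup.S 4 UpperHalfPlane.I
    rw [integral_eq_fCoeff (by norm_num), ← slashS_eq_sl] at h
    rw [c0Coeff, show (4 : ℂ) = (4 : ℕ) by norm_num, ← h, ← hB (ModularGroup.S • UpperHalfPlane.I)]
    congr 3
    simp only [smul_smul]; congr 1; decide +revert
  have hP' : P = 0 := by
    rw [← norm_le_zero_iff]
    refine le_of_forall_pos_le_add fun ε hε => ?_
    have hU' := (Metric.tendsto_nhds.1 hU) ε hε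
    rw [atImInfty, eventually_comap] at hU'
    obtain ⟨y, hy⟩ := Filter.eventually_atTop.1 hU'
    obtain ⟨τ, hτ⟩ : ∃ τ : ℍ, y ≤ τ.im :=
      ⟨⟨(max y 1 : ℝ) * Complex.I, by simp⟩, by simp [UpperHalfPlane.im]⟩
    have h := primitive_sub_eq_integral hF.holo hH matU 1 τ
    have h2 : (matU • ModularGroup.T • τ) = (matU * ModularGroup.T * matU⁻¹) • matU • τ := by
      simp only [smul_smul]; simp
    rw [Nat.cast_one, _root_.zpow_one, h2, hP] at h
    rw [h, zero_add]
    refine (intervalIntegral.norm_integral_le_of_norm_le_const (C := ε) fun x _ => ?_).trans ?_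
    · have := hy τ.im hτ (x +ᵥ τ) (vadd_im x τ)
      rw [dist_zero_right] at this
      exact this.le
    · simp
  have hmul : (matU * ModularGroup.T * matU⁻¹) = -(matL * ModularGroup.T⁻¹) := by decide
  have h3 := hP (ModularGroup.T • matL⁻¹ • UpperHalfPlane.I)
  have h4 : (matU * ModularGroup.T * matU⁻¹) • (ModularGroup.T • matL⁻¹ • UpperHalfPlane.I) =
      UpperHalfPlane.I := by
    rw [hmul, ModularGroup.SL_neg_smul]
    simp only [smul_smul]; simp
  rw [h4, hP'] at h3
  have h5 := hA (matL⁻¹ • UpperHalfPlane.I)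
  have h6 := hB UpperHalfPlane.I
  rw [← hA', ← hB', ← h5, ← h6]
  linear_combination -h3

namespace Form
variable {m n s t : ℤ} {f g : ℍ → ℂ}

lemma reg_half (h : Form m s f) : Reg 4 (sl (m / 2) f matU) where
  pos := by norm_num
  holo := mdifferentiable_slash h.holo _ _
  per τ := h.aut.sl_T_four _ τ
  bdd := h.half

lemma tendsto_half (h : Form m s f) (hm : Odd m) :
    Tendsto (sl (m / 2) f matU) atImInfty (𝓝 0) := by
  have hl := h.reg_half.tendsto
  have hT := (hl.comp (tendsto_T_zpow_smul 1)).congr fun τ => by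
    rw [Function.comp_apply, _root_.zpow_one, h.aut.sl_matU_T]
  have heq := tendsto_nhds_unique hT (hl.const_mul (Complex.I ^ m))
  have hI : Complex.I ^ m ≠ 1 := by
    intro hI
    have h2 : (Complex.I ^ m) ^ 2 = 1 := by rw [hI, one_pow]
    rw [← zpow_natCast, ← _root_.zpow_mul, mul_comm, _root_.zpow_mul, zpow_natCast,
      Complex.I_sq, hm.neg_one_zpow] at h2
    norm_num at h2
  have h0 : qc 4 (sl (m / 2) f matU) 0 = 0 := by
    have : (Complex.I ^ m - 1) * qc 4 (sl (m / 2) f matU) 0 = 0 := by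
      linear_combination -heq
    exact (mul_eq_zero.1 this).resolve_left (sub_ne_zero.2 hI)
  rwa [h0] at hl

lemma tendsto_zero (h : Form m s f) :
    Tendsto (sl (m / 2) f ModularGroup.S) atImInfty (𝓝 (c0Coeff (m / 2) f)) := by
  rw [c0Coeff, slashS_eq_sl]
  have := h.reg_zero.fCoeff_eq_qc 0
  rw [Nat.cast_zero] at this
  rw [this]
  exact h.reg_zero.tendsto

lemma c0Coeff_mul (hf : Form m s f) (hg : Form n t g) :
    c0Coeff ((m + n : ℤ) / 2) (fun τ => f τ * g τ) =
      c0Coeff (m / 2) f * c0Coeff (n / 2) g := by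
  refine tendsto_nhds_unique (hf.mul hg).tendsto_zero
    ((hf.tendsto_zero.mul hg.tendsto_zero).congr fun τ => ?_)
  rw [sl_mul_apply, ← add_div, ← Int.cast_add]

lemma fCoeff_eq_qc (h : Form m s f) (n : ℕ) :
    fCoeff 1 (n - s) f = qc 1 (fun τ : ℍ => f τ * nome τ ^ s) n := by
  rw [fCoeff_shift 1 _ s, sub_add_cancel, ← h.reg_inf.fCoeff_eq_qc n]
  simp only [Nat.cast_one, div_one]

/-- Vanishing of the leading coefficient at `∞` lowers the order of the pole. -/
lemma sub_one (h : Form m s f) (h0 : fCoeff 1 (-s) f = 0) : Form m (s - 1) f where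
  __ := h
  inf := by
    have hr := h.reg_inf
    have hv := h.fCoeff_eq_qc 0
    rw [Nat.cast_zero, zero_sub, h0, qc, qExpansion_coeff_zero hr.pos' hr.analyticAt hr.periodic]
      at hv
    have hexp := exp_decay_sub_atImInfty hr.pos' hr.periodic hr.holo hr.bdd
    rw [← hv] at hexp
    simp only [sub_zero] at hexp
    have h1 : (fun τ : ℍ => nome τ ^ (-1 : ℤ)) =O[atImInfty]
        (fun τ : ℍ => (Real.exp (-2 * Real.pi * τ.im / (1 : ℕ)))⁻¹) := by
      refine Asymptotics.isBigO_of_le _ fun τ => ?_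
      rw [_root_.zpow_neg, _root_.zpow_one, norm_inv, norm_nome, norm_inv, Real.norm_eq_abs,
        abs_of_pos (Real.exp_pos _)]
      simp
    refine IsBounded.congr (f := fun τ : ℍ => f τ * nome τ ^ s * nome τ ^ (-1 : ℤ)) ?_
      fun τ => ?_
    · refine (hexp.mul h1).congr_right fun τ => ?_
      rw [Pi.one_apply]
      exact mul_inv_cancel₀ (Real.exp_pos _).ne'
    · rw [mul_assoc, ← zpow_add₀ (nome_ne_zero _), sub_eq_add_neg]

lemma sub_natCast (h : Form m s f) (n : ℕ) (h0 : ∀ j : ℕ, j < n → fCoeff 1 (j - s) f = 0) :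
    Form m (s - n) f := by
  induction n with
  | zero => simpa using h
  | succ n ih =>
    have := (ih fun j hj => h0 j (hj.trans n.lt_succ_self)).sub_one
      (by rw [neg_sub]; exact h0 n n.lt_succ_self)
    rwa [sub_sub] at this

lemma eq_const (h : Form 0 0 f) : ∃ c, ∀ τ, f τ = c := by
  refine eq_const_of_invariant h.holo (fun γ hγ τ => ?_) ?_ ?_ ?_
  · rw [h.aut γ hγ, _root_.zpow_zero, one_mul]
  · exact IsBounded.congr h.inf fun τ => by simp
  · exact IsBounded.congr h.zero fun τ => by simp [sl]
  · exact IsBounded.congr h.half fun τ => by simp [sl]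

/-- A holomorphic form of weight `2` on `Γ₀(4)` vanishing at the cusps `0` and `1/2` is zero. -/
lemma eq_zero_of_weight_two (h : Form 4 0 f) (h0 : c0Coeff 2 f = 0)
    (hU : Tendsto (sl 2 f matU) atImInfty (𝓝 0)) : f = 0 := by
  have hres := h.fCoeff_add_c0Coeff hU
  rw [h0, mul_zero, add_zero] at hres
  have h1 := h.sub_one (by rwa [neg_zero])
  have h2 := h1.mul form_R4_inv
  obtain ⟨c, hc⟩ := Form.eq_const (by simpa using h2)
  have h3 := h1.c0Coeff_mul form_R4_inv
  rw [show ((4 : ℤ) : ℂ) / 2 = 2 by norm_num, h0, zero_mul] at h3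
  have h4 := h2.tendsto_zero
  rw [h3] at h4
  have hc0 : c = 0 := by
    refine tendsto_nhds_unique (tendsto_const_nhds.congr fun τ => ?_) h4
    simp [sl, hc]
  funext τ
  have := hc τ
  rw [hc0] at this
  exact (mul_eq_zero.1 this).resolve_right (inv_ne_zero (R4_ne_zero τ))

/-- A holomorphic form of weight at most `1/2` vanishing at the cusp `0` is zero. -/
lemma eq_zero_of_c0Coeff {k : ℕ} (h : Form (1 - 2 * k) 0 f)
    (h0 : c0Coeff ((1 - 2 * k : ℤ) / 2) f = 0) : f = 0 := by
  have hΘ := form_Theta.pow (2 * k + 3)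
  have h1 := h.mul hΘ
  have hm : (1 - 2 * k : ℤ) + ((2 * k + 3 : ℕ) : ℤ) * 1 = 4 := by push_cast; ring
  have h2 := h.c0Coeff_mul hΘ
  have hU := (h.tendsto_half ⟨-k, by ring⟩).mul hΘ.reg_half.tendsto
  simp only [sl_mul_apply, ← add_div, ← Int.cast_add, zero_mul] at hU
  rw [h0, zero_mul] at h2
  rw [hm] at h1 h2 hU
  rw [mul_zero, add_zero] at h1
  rw [show ((4 : ℤ) : ℂ) / 2 = 2 by norm_num] at h2 hU
  have h3 := h1.eq_zero_of_weight_two h2 hU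
  funext τ
  exact (mul_eq_zero.1 (congrFun h3 τ)).resolve_right (pow_ne_zero _ (Theta_ne_zero τ))

lemma inv_R4_pow (e : ℕ) : Form (-4 * e) e (fun τ => (R4 τ ^ e)⁻¹) := by
  have := form_R4_inv.pow e
  simp only [inv_pow] at this
  convert this using 1 <;> ring

lemma div_R4_pow (h : Form m s f) (e : ℕ) :
    Form (m - 4 * e) (s + e) (fun τ => f τ / R4 τ ^ e) := by
  simp only [div_eq_mul_inv]
  convert h.mul (inv_R4_pow e) using 1
  ring

/-- A form is determined by its coefficients up to the Sturm-type bound together with its constant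
term at the cusp `0`. -/
lemma eq_zero_of_coeff (h : Form m s f) (k N : ℕ) (l : ℕ) (hk : m - 4 * l = 1 - 2 * k)
    (hN : s - N = -l) (h0 : ∀ j : ℕ, j < N → fCoeff 1 (j - s) f = 0)
    (hc : c0Coeff (m / 2) f = 0) : f = 0 := by
  have h1 := (h.sub_natCast N h0).mul (inv_R4_pow l)
  have h2 := h.c0Coeff_mul (inv_R4_pow l)
  have hm : m + -4 * (l : ℤ) = 1 - 2 * k := by rw [← hk]; ring
  rw [hc, zero_mul] at h2
  rw [hm] at h1 h2
  rw [hN, neg_add_cancel] at h1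
  have h3 := h1.eq_zero_of_c0Coeff h2
  funext τ
  exact (mul_eq_zero.1 (congrFun h3 τ)).resolve_right
    (inv_ne_zero (pow_ne_zero _ (R4_ne_zero τ)))

/-- The pairing between forms of complementary weights given by the residue theorem. -/
lemma sum_coeff_mul {e : ℕ} (hf : Form m 0 f) (hg : Form n e g) (hm : Odd m) (hmn : m + n = 4) :
    ∑ i ∈ Finset.range (e + 1), fCoeff 1 (-i) g * fCoeff 1 i f +
      4 * c0Coeff (n / 2) g * c0Coeff (m / 2) f = 0 := by
  have h := hf.mul hg
  have h2 := hf.c0Coeff_mul hg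
  have hU := (hf.tendsto_half hm).mul hg.reg_half.tendsto
  simp only [sl_mul_apply, ← add_div, ← Int.cast_add, zero_mul] at hU
  have hq := h.fCoeff_eq_qc e
  rw [zero_add, sub_self] at hq
  rw [zero_add] at h
  rw [hmn] at h h2 hU
  rw [show ((4 : ℤ) : ℂ) / 2 = 2 by norm_num] at h2 hU
  have hres := h.fCoeff_add_c0Coeff hU
  have hprod : (fun τ : ℍ => f τ * g τ * nome τ ^ (e : ℤ)) =
      fun τ : ℍ => (f τ * nome τ ^ (0 : ℤ)) * (g τ * nome τ ^ (e : ℤ)) := by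
    funext τ; rw [_root_.zpow_zero]; ring
  rw [hq, h2, hprod, hf.reg_inf.qc_mul hg.reg_inf,
    Finset.Nat.sum_antidiagonal_eq_sum_range_succ_mk] at hres
  rw [← hres]
  congr 1
  · refine Finset.sum_congr rfl fun i hi => ?_
    have hi' : i ≤ e := Nat.lt_succ_iff.1 (Finset.mem_range.1 hi)
    rw [← hf.fCoeff_eq_qc, ← hg.fCoeff_eq_qc, sub_zero, Nat.cast_sub hi', mul_comm]
    congr 2
    ring
  · ring

end Form

lemma hpt_continuous : Continuous hpt := by
  rw [UpperHalfPlane.isEmbedding_coe.continuous_iff]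
  have : ((↑) : ℍ → ℂ) ∘ hpt = fun x : ℝ => (x : ℂ) + Complex.I := rfl
  rw [this]
  fun_prop

lemma fCoeff_smul_add {f g : ℍ → ℂ} (hf : Continuous f) (hg : Continuous g) (M : ℕ) (n : ℤ)
    (c : ℂ) : fCoeff M n (fun τ => c * f τ + g τ) = c * fCoeff M n f + fCoeff M n g := by
  have hi {F : ℍ → ℂ} (hF : Continuous F) : IntervalIntegrable (fun x : ℝ => F (hpt x) *
      Complex.exp (-(2 * Real.pi * Complex.I * n * ((x : ℂ) + Complex.I) / M)))
      MeasureTheory.volume 0 M := by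
    refine Continuous.intervalIntegrable ((hF.comp hpt_continuous).mul ?_) _ _
    fun_prop
  simp only [fCoeff, add_mul, mul_assoc]
  have h1 := hi hf
  have h2 := hi hg
  simp only [mul_assoc] at h1 h2
  rw [intervalIntegral.integral_add (h1.const_mul c) h2, intervalIntegral.integral_const_mul]
  ring

lemma c0Coeff_smul_add {f g : ℍ → ℂ} (hf : MDifferentiable 𝓘(ℂ) 𝓘(ℂ) f)
    (hg : MDifferentiable 𝓘(ℂ) 𝓘(ℂ) g) (w c : ℂ) :
    c0Coeff w (fun τ => c * f τ + g τ) = c * c0Coeff w f + c0Coeff w g := by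
  simp only [c0Coeff, slashS_eq_sl]
  rw [← fCoeff_smul_add (mdifferentiable_slash hf _ _).continuous
    (mdifferentiable_slash hg _ _).continuous]
  congr 1
  funext τ
  exact sl_smul_add _ _ _ _ _ _

lemma form_zero (m s : ℤ) : Form m s 0 where
  holo := mdifferentiable_const (c := 0)
  aut _ _ _ := by simp
  inf := IsBounded.congr (IsBounded.const 0) fun τ => by simp
  zero := IsBounded.congr (IsBounded.const 0) fun τ => by simp [sl]
  half := IsBounded.congr (IsBounded.const 0) fun τ => by simp [sl]

/-- Holomorphic forms of weight `m / 2` on `Γ₀(4)`. -/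
def formSpace (m : ℤ) : Submodule ℂ (ℍ → ℂ) where
  carrier := {f | Form m 0 f}
  zero_mem' := form_zero m 0
  add_mem' {f g} hf hg := by
    have := Form.smul_add hf hg 1
    simp only [one_mul] at this
    exact this
  smul_mem' c f hf := by
    have := Form.smul_add hf (form_zero m 0) c
    simp only [Pi.zero_apply, add_zero] at this
    exact this

/-- The vector of coefficients whose values make up `EV`. -/
def coeffVec (lam e : ℕ) (f : ℍ → ℂ) : Fin (e + 2) → ℂ := fun i =>
  if (i : ℕ) = 0 then fCoeff 1 0 f
  else if (i : ℕ) = 1 then c0Coeff ((lam : ℂ) + 1 / 2) f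
  else fCoeff 1 (((i : ℕ) : ℤ) - 1) f

section Maps
variable (lam e : ℕ)

lemma coeffVec_smul_add {f g : ℍ → ℂ} (hf : MDifferentiable 𝓘(ℂ) 𝓘(ℂ) f)
    (hg : MDifferentiable 𝓘(ℂ) 𝓘(ℂ) g) (c : ℂ) (i : Fin (e + 2)) :
    coeffVec lam e (fun τ => c * f τ + g τ) i = c * coeffVec lam e f i + coeffVec lam e g i := by
  simp only [coeffVec]
  split_ifs
  · exact fCoeff_smul_add hf.continuous hg.continuous _ _ _
  · exact c0Coeff_smul_add hf hg _ _
  · exact fCoeff_smul_add hf.continuous hg.continuous _ _ _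

lemma PhiMap_smul_add {f g : ℍ → ℂ} (hf : MDifferentiable 𝓘(ℂ) 𝓘(ℂ) f)
    (hg : MDifferentiable 𝓘(ℂ) 𝓘(ℂ) g) (c : ℂ) (i : Fin (e + 2)) :
    PhiMap lam e (fun τ => c * f τ + g τ) i = c * PhiMap lam e f i + PhiMap lam e g i := by
  have hR (F : ℍ → ℂ) (hF : MDifferentiable 𝓘(ℂ) 𝓘(ℂ) F) :
      MDifferentiable 𝓘(ℂ) 𝓘(ℂ) (fun τ => F τ / R4 τ ^ e) :=
    mdiff_div hF (mdiff_pow mdifferentiable_R4 e) fun τ => pow_ne_zero _ (R4_ne_zero τ)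
  have h1 : (fun τ => (c * f τ + g τ) / R4 τ ^ e) =
      fun τ => c * (f τ / R4 τ ^ e) + g τ / R4 τ ^ e := by
    funext τ; ring
  simp only [PhiMap, h1]
  split_ifs
  · exact fCoeff_smul_add (hR f hf).continuous (hR g hg).continuous _ _ _
  · rw [c0Coeff_smul_add (hR f hf) (hR g hg)]
    ring
  · exact fCoeff_smul_add (hR f hf).continuous (hR g hg).continuous _ _ _

/-- `coeffVec` as a linear map on a space of forms. -/
def coeffLin (m : ℤ) : formSpace m →ₗ[ℂ] (Fin (e + 2) → ℂ) where
  toFun f := coeffVec lam e f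
  map_add' f g := by
    funext i
    have := coeffVec_smul_add lam e f.2.holo g.2.holo 1 i
    simp only [one_mul] at this
    exact this
  map_smul' c f := by
    funext i
    have := coeffVec_smul_add lam e f.2.holo f.2.holo (c - 1) i
    simp only [sub_one_mul, sub_add_cancel] at this
    exact this

/-- `PhiMap` as a linear map on a space of forms. -/
def phiLin (m : ℤ) : formSpace m →ₗ[ℂ] (Fin (e + 2) → ℂ) where
  toFun f := PhiMap lam e f
  map_add' f g := by
    funext i
    have := PhiMap_smul_add lam e f.2.holo g.2.holo 1 i
    simp only [one_mul] at this
    exact this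
  map_smul' c f := by
    funext i
    have := PhiMap_smul_add lam e f.2.holo f.2.holo (c - 1) i
    simp only [sub_one_mul, sub_add_cancel] at this
    exact this

variable {lam e}

lemma fCoeff_eq_zero_of_coeffVec {f : ℍ → ℂ} (h : coeffVec lam e f = 0) (j : ℕ)
    (hj : j < e + 1) : fCoeff 1 j f = 0 := by
  rcases j with _ | j
  · exact congrFun h 0
  · have := congrFun h ⟨j + 2, by omega⟩
    simp only [coeffVec, Pi.zero_apply] at this
    rw [if_neg (by omega), if_neg (by omega)] at this
    rw [← this]
    congr 1
    push_cast; ring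

lemma c0Coeff_eq_zero_of_coeffVec {f : ℍ → ℂ} (h : coeffVec lam e f = 0) :
    c0Coeff ((lam : ℂ) + 1 / 2) f = 0 := by
  have := congrFun h 1
  simpa [coeffVec] using this

lemma fCoeff_eq_zero_of_PhiMap {g : ℍ → ℂ} (h : PhiMap lam e g = 0) (j : ℕ)
    (hj : j < e + 1) : fCoeff 1 (j - e) (fun τ => g τ / R4 τ ^ e) = 0 := by
  rcases (Nat.lt_succ_iff.1 hj).eq_or_lt with rfl | hj
  · rw [sub_self]
    exact congrFun h 0
  · have := congrFun h ⟨e - j + 1, by omega⟩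
    simp only [PhiMap, Pi.zero_apply] at this
    rw [if_neg (by omega), if_neg (by omega)] at this
    rw [← this]
    congr 1
    omega

lemma c0Coeff_eq_zero_of_PhiMap {g : ℍ → ℂ} (h : PhiMap lam e g = 0) :
    c0Coeff ((1 - (lam : ℂ)) + 1 / 2) (fun τ => g τ / R4 τ ^ e) = 0 := by
  have := congrFun h 1
  simpa [PhiMap] using this

lemma coeffLin_injective (hle : (lam : ℤ) - 2 ≤ 2 * e) :
    Function.Injective (coeffLin lam e (2 * lam + 1)) := by
  refine (injective_iff_map_eq_zero _).2 fun f hf => Subtype.ext ?_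
  obtain ⟨k, hk⟩ := Int.eq_ofNat_of_zero_le (show 0 ≤ 2 * (e : ℤ) + 2 - lam by omega)
  refine Form.eq_zero_of_coeff f.2 k (e + 1) (e + 1) (by push_cast; omega) (by push_cast; omega)
    (fun j hj => ?_) ?_
  · rw [sub_zero]
    exact fCoeff_eq_zero_of_coeffVec hf j hj
  · rw [show ((2 * lam + 1 : ℤ) : ℂ) / 2 = (lam : ℂ) + 1 / 2 by push_cast; ring]
    exact c0Coeff_eq_zero_of_coeffVec hf

lemma form_div_R4_pow {g : ℍ → ℂ} (hg : Form (2 * (2 * e - lam + 1 : ℤ) + 1) 0 g) :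
    Form (2 * (1 - lam : ℤ) + 1) e (fun τ => g τ / R4 τ ^ e) := by
  convert hg.div_R4_pow e using 1 <;> ring

lemma weight_compl : ((2 * (1 - lam : ℤ) + 1 : ℤ) : ℂ) / 2 = (1 - (lam : ℂ)) + 1 / 2 := by
  push_cast; ring

lemma phiLin_injective : Function.Injective (phiLin lam e (2 * (2 * e - lam + 1 : ℤ) + 1)) := by
  refine (injective_iff_map_eq_zero _).2 fun g hg => Subtype.ext ?_
  have h := Form.eq_zero_of_coeff (form_div_R4_pow g.2) (lam + 1) (e + 1) 1 (by push_cast; ring)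
    (by push_cast; ring) (fun j hj => fCoeff_eq_zero_of_PhiMap hg j hj)
    (by rw [weight_compl]; exact c0Coeff_eq_zero_of_PhiMap hg)
  funext τ
  exact (div_eq_zero_iff.1 (congrFun h τ)).resolve_right (pow_ne_zero _ (R4_ne_zero τ))

lemma sum_PhiMap_mul_coeffVec {f g : ℍ → ℂ} (hf : Form (2 * lam + 1) 0 f)
    (hg : Form (2 * (2 * e - lam + 1 : ℤ) + 1) 0 g) :
    ∑ i, PhiMap lam e g i * coeffVec lam e f i = 0 := by
  have h := Form.sum_coeff_mul hf (form_div_R4_pow hg) ⟨lam, rfl⟩ (by ring)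
  rw [weight_compl, show ((2 * lam + 1 : ℤ) : ℂ) / 2 = (lam : ℂ) + 1 / 2 by push_cast; ring,
    Finset.sum_range_succ', Finset.sum_range] at h
  rw [Fin.sum_univ_succ, Fin.sum_univ_succ, ← h]
  have hi (i : Fin e) : PhiMap lam e g i.succ.succ * coeffVec lam e f i.succ.succ =
      fCoeff 1 (-((i : ℕ) + 1 : ℕ)) (fun τ => g τ / R4 τ ^ e) * fCoeff 1 ((i : ℕ) + 1 : ℕ) f := by
    simp only [PhiMap, coeffVec, Fin.val_succ]
    simp
  simp only [hi]
  simp only [PhiMap, coeffVec]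
  simp
  ring

end Maps

lemma tendsto_R4_div_Theta : Tendsto (fun τ : ℍ => R4 τ / Theta τ ^ 4) atImInfty (𝓝 0) := by
  have hn := tendsto_nome one_pos 0
  simp only [ofReal_one, one_mul, add_zero] at hn
  have h := (tendsto_R4_mul.mul hn).div (tendsto_Theta.pow 4) (by norm_num)
  simp only [mul_zero, zero_div] at h
  refine h.congr fun τ => ?_
  simp only [Pi.div_apply]
  rw [_root_.zpow_neg, _root_.zpow_one, inv_mul_cancel_right₀ (nome_ne_zero _)]

lemma infinite_range_R4_div_Theta : (Set.range fun τ : ℍ => R4 τ / Theta τ ^ 4).Infinite := by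
  intro hfin
  obtain ⟨τ, hτ⟩ := hfin.isClosed.mem_of_tendsto tendsto_R4_div_Theta
    (Eventually.of_forall fun τ => Set.mem_range_self τ)
  exact div_ne_zero (R4_ne_zero τ) (pow_ne_zero _ (Theta_ne_zero τ)) hτ

lemma linearIndependent_Theta_R4 (k : ℕ) : LinearIndependent ℂ
    (fun (i : Fin (k / 2 + 1)) (τ : ℍ) => Theta τ ^ (2 * k + 1 - 4 * (i : ℕ)) * R4 τ ^ (i : ℕ)) := by
  refine Fintype.linearIndependent_iff.2 fun c hc i => ?_
  set p : Polynomial ℂ := ∑ i : Fin (k / 2 + 1), Polynomial.monomial (i : ℕ) (c i) with hp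
  have hroot : Set.range (fun τ : ℍ => R4 τ / Theta τ ^ 4) ⊆ {x | p.IsRoot x} := by
    rintro _ ⟨τ, rfl⟩
    have hτ := congrFun hc τ
    have hΘ := Theta_ne_zero τ
    simp only [Finset.sum_apply, Pi.smul_apply, smul_eq_mul, Pi.zero_apply] at hτ
    refine (mul_eq_zero.1 (?_ : Theta τ ^ (2 * k + 1) * p.eval (R4 τ / Theta τ ^ 4) = 0)).resolve_left
      (pow_ne_zero _ hΘ)
    rw [← hτ, hp, Polynomial.eval_finsetSum, Finset.mul_sum]
    refine Finset.sum_congr rfl fun i _ => ?_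
    have hi : 4 * (i : ℕ) + (2 * k + 1 - 4 * (i : ℕ)) = 2 * k + 1 := by omega
    rw [Polynomial.eval_monomial, div_pow, ← pow_mul]
    nth_rewrite 1 [← hi]
    rw [pow_add]
    field_simp
  have h0 := Polynomial.eq_zero_of_infinite_isRoot p (infinite_range_R4_div_Theta.mono hroot)
  have hcoeff : p.coeff (i : ℕ) = c i := by
    rw [hp, Polynomial.finsetSum_coeff, Finset.sum_eq_single i]
    · simp
    · intro j _ hj
      rw [Polynomial.coeff_monomial, if_neg fun h => hj (Fin.ext h)]
    · simp
  rw [← hcoeff, h0, Polynomial.coeff_zero]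

lemma form_Theta_R4 {k i : ℕ} (hi : i ≤ k / 2) :
    Form (2 * k + 1) 0 (fun τ => Theta τ ^ (2 * k + 1 - 4 * i) * R4 τ ^ i) := by
  have h := ((form_Theta.pow (2 * k + 1 - 4 * i)).mul (form_R4.pow i)).mono (t := 0) (by simp)
  convert h using 1
  push_cast [show 4 * i ≤ 2 * k + 1 by omega]
  ring

lemma card_le_finrank_formSpace (k : ℕ) [Module.Finite ℂ (formSpace (2 * k + 1))] :
    k / 2 + 1 ≤ Module.finrank ℂ (formSpace (2 * k + 1)) := by
  have h : LinearIndependent ℂ (fun i : Fin (k / 2 + 1) =>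
      (⟨_, form_Theta_R4 (Nat.lt_succ_iff.1 i.2)⟩ : formSpace (2 * k + 1))) :=
    LinearIndependent.of_comp (formSpace (2 * k + 1)).subtype (linearIndependent_Theta_R4 k)
  simpa using h.fintype_card_le_finrank

/-- Two orthogonal subspaces of complementary dimension are each other's annihilator. -/
lemma mem_of_forall_sum_mul_eq_zero {ι : Type*} [Fintype ι] {V W : Submodule ℂ (ι → ℂ)}
    (hVW : ∀ v ∈ V, ∀ w ∈ W, ∑ i, w i * v i = 0)
    (hdim : Fintype.card ι ≤ Module.finrank ℂ V + Module.finrank ℂ W) {w : ι → ℂ}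
    (hw : ∀ v ∈ V, ∑ i, w i * v i = 0) : w ∈ W := by
  classical
  set A : Submodule ℂ (ι → ℂ) :=
    V.dualAnnihilator.map ((dotProductEquiv ℂ ι).symm : Module.Dual ℂ (ι → ℂ) →ₗ[ℂ] (ι → ℂ)) with hA
  have hmem (w : ι → ℂ) : w ∈ A ↔ ∀ v ∈ V, ∑ i, w i * v i = 0 := by
    rw [hA, Submodule.mem_map_equiv, Submodule.mem_dualAnnihilator]
    rfl
  have hrank : Module.finrank ℂ A = Module.finrank ℂ V.dualAnnihilator :=
    LinearEquiv.finrank_map_eq _ _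
  have hV := Subspace.finrank_add_finrank_dualAnnihilator_eq V
  rw [Module.finrank_fintype_fun_eq_card] at hV
  have hle : W ≤ A := fun w hw => (hmem w).2 fun v hv => hVW v hv w hw
  rw [Submodule.eq_of_le_of_finrank_le hle (by omega)]
  exact (hmem w).2 hw

/-- For `2e ≥ λ − 2` and `r = 2e − λ + 1`: for `g ∈ M_{r+1/2}(Γ₀(4))` the
quotient `g/R₄^e` is weakly holomorphic of weight `(1−λ)+1/2` on `Γ₀(4)`, and
`Φ : M_{r+1/2}(Γ₀(4)) → ℂ^{e+2}` is a `ℂ`-linear isomorphism onto `EL`. -/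
theorem statement10 (lam e : ℕ) (he : 1 ≤ e) (hle : (lam : ℤ) - 2 ≤ 2 * e) :
    (∀ g : ℍ → ℂ, IsHoloForm 1 (2 * e - lam + 1 : ℤ) g →
      IsWeaklyHolo 1 (1 - (lam : ℤ)) (fun τ => g τ / R4 τ ^ e)) ∧
    (∀ g₁ g₂ : ℍ → ℂ, IsHoloForm 1 (2 * e - lam + 1 : ℤ) g₁ →
      IsHoloForm 1 (2 * e - lam + 1 : ℤ) g₂ → ∀ c : ℂ,
        PhiMap lam e (fun τ => c * g₁ τ + g₂ τ) =
          fun i => c * PhiMap lam e g₁ i + PhiMap lam e g₂ i) ∧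
    (∀ g₁ g₂ : ℍ → ℂ, IsHoloForm 1 (2 * e - lam + 1 : ℤ) g₁ →
      IsHoloForm 1 (2 * e - lam + 1 : ℤ) g₂ →
        PhiMap lam e g₁ = PhiMap lam e g₂ → g₁ = g₂) ∧
    (∀ g : ℍ → ℂ, IsHoloForm 1 (2 * e - lam + 1 : ℤ) g → PhiMap lam e g ∈ EL lam e) ∧
    (∀ w ∈ EL lam e, ∃ g : ℍ → ℂ,
      IsHoloForm 1 (2 * e - lam + 1 : ℤ) g ∧ PhiMap lam e g = w) := by
  simp only [isHoloForm_iff]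
  have hEV (f : ℍ → ℂ) (hf : Form (2 * lam + 1) 0 f) : coeffVec lam e f ∈ EV lam e :=
    ⟨f, isHoloForm_iff.2 hf, rfl⟩
  have hEL (w : Fin (e + 2) → ℂ) : w ∈ EL lam e ↔
      ∀ f, Form (2 * lam + 1) 0 f → ∑ i, w i * coeffVec lam e f i = 0 := by
    refine ⟨fun hw f hf => hw _ (hEV f hf), fun hw => ?_⟩
    rintro _ ⟨f, hf, rfl⟩
    exact hw f (isHoloForm_iff.1 hf)
  have hpair (f g : ℍ → ℂ) (hf : Form (2 * lam + 1) 0 f)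
      (hg : Form (2 * (2 * e - lam + 1 : ℤ) + 1) 0 g) :
      ∑ i, PhiMap lam e g i * coeffVec lam e f i = 0 := sum_PhiMap_mul_coeffVec hf hg
  refine ⟨fun g hg => (form_div_R4_pow hg).isWeaklyHolo,
    fun g₁ g₂ h₁ h₂ c => funext fun i => PhiMap_smul_add lam e h₁.holo h₂.holo c i,
    fun g₁ g₂ h₁ h₂ h => congrArg Subtype.val (phiLin_injective (lam := lam) (e := e)
      (a₁ := ⟨g₁, h₁⟩) (a₂ := ⟨g₂, h₂⟩) h),
    fun g hg => (hEL _).2 fun f hf => hpair f g hf hg, fun w hw => ?_⟩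
  have hinj := coeffLin_injective hle
  have hinj' := phiLin_injective (lam := lam) (e := e)
  have hfin := Module.Finite.of_injective _ hinj
  have hfin' := Module.Finite.of_injective _ hinj'
  have hdim := card_le_finrank_formSpace lam
  have hdim' : e + 1 ≤ lam / 2 +
      Module.finrank ℂ (formSpace (2 * (2 * e - lam + 1 : ℤ) + 1)) := by
    by_cases hr : 0 ≤ (2 * e - lam + 1 : ℤ)
    · obtain ⟨k, hk⟩ := Int.eq_ofNat_of_zero_le hr
      rw [hk] at hfin' ⊢
      have := card_le_finrank_formSpace k
      omega
    · omega
  have hmem : w ∈ LinearMap.range (phiLin lam e (2 * (2 * e - lam + 1 : ℤ) + 1)) := by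
    refine mem_of_forall_sum_mul_eq_zero
      (V := LinearMap.range (coeffLin lam e (2 * lam + 1))) ?_ ?_ ?_
    · rintro _ ⟨f, rfl⟩ _ ⟨g, rfl⟩
      exact hpair f g f.2 g.2
    · rw [LinearMap.finrank_range_of_inj hinj, LinearMap.finrank_range_of_inj hinj',
        Fintype.card_fin]
      omega
    · rintro _ ⟨f, rfl⟩
      exact (hEL w).1 hw f f.2
  obtain ⟨g, hg⟩ := hmem
  exact ⟨g, g.2, hg⟩

end
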